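/- arXiv:1402.3570 — 11 statements merged into one kernel-verified Lean document; each statement's English description precedes it below -/
import Mathlib

section
/- Let L be a convex cone of real random variables on (Ω, 𝒜, P₀). There exists an equivalent super-martingale measure (ESM) for L if and only if there exist a σ-additive probability measure Q on 𝒜 with Q ~ P₀ and a constant k ≥ 0 such that every X ∈ L is Q-integrable and E_Q(X) ≤ k·E_Q(X⁻) for every X ∈ L. -/
open MeasureTheory Filter Topology

/-- Hahn–Banach for a sublinear functional `p` and a convex cone `C`: if `p` is nonnegative on `-C`,
then some linear functional dominated by `p` is nonpositive on `C`. -/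
theorem exists_linearMap_le_sublinear_nonpos_on_cone {E : Type*} [AddCommGroup E] [Module ℝ E]
    (p : E → ℝ) (hsmul : ∀ c : ℝ, 0 < c → ∀ x, p (c • x) = c * p x)
    (hadd : ∀ x y, p (x + y) ≤ p x + p y) (C : Set E) (hC : C.Nonempty)
    (hCadd : ∀ x ∈ C, ∀ y ∈ C, x + y ∈ C) (hCsmul : ∀ x ∈ C, ∀ c : ℝ, 0 ≤ c → c • x ∈ C)
    (hneg : ∀ y ∈ C, 0 ≤ p (-y)) :
    ∃ g : E →ₗ[ℝ] ℝ, (∀ x, g x ≤ p x) ∧ ∀ y ∈ C, g y ≤ 0 := by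
  have h0C : (0 : E) ∈ C := by
    obtain ⟨x, hx⟩ := hC
    simpa using hCsmul x hx 0 le_rfl
  have hp0 : p 0 = 0 := by
    have := hsmul 2 two_pos 0
    rw [smul_zero] at this
    linarith
  have : Nonempty C := ⟨⟨0, h0C⟩⟩
  let N : E → ℝ := fun x => ⨅ y : C, p (x - y)
  have hbdd : ∀ x, BddBelow (Set.range fun y : C => p (x - y)) := fun x => by
    refine ⟨-p (-x), ?_⟩
    rintro _ ⟨y, rfl⟩
    have h1 := hadd (x - y) (-x)
    rw [show x - (y : E) + -x = -y by abel] at h1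
    have h2 := hneg y y.2
    simp only
    linarith
  have hN_le : ∀ x, ∀ y ∈ C, N x ≤ p (x - y) := fun x y hy => ciInf_le (hbdd x) ⟨y, hy⟩
  have hN_smul_le : ∀ c : ℝ, 0 < c → ∀ x, N (c • x) ≤ c * N x := fun c hc x => by
    rw [← div_le_iff₀' hc]
    refine le_ciInf fun y => ?_
    rw [div_le_iff₀' hc, ← hsmul c hc, smul_sub]
    exact hN_le _ _ (hCsmul y y.2 c hc.le)
  have hN_smul : ∀ c : ℝ, 0 < c → ∀ x, N (c • x) = c * N x := fun c hc x => by
    refine le_antisymm (hN_smul_le c hc x) ?_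
    have h := hN_smul_le c⁻¹ (inv_pos.2 hc) (c • x)
    rwa [inv_smul_smul₀ hc.ne', ← div_eq_inv_mul, le_div_iff₀' hc] at h
  have hN_add : ∀ x y, N (x + y) ≤ N x + N y := fun x y => by
    refine le_ciInf_add_ciInf fun a b => ?_
    refine (hN_le _ _ (hCadd a a.2 b b.2)).trans ?_
    rw [add_sub_add_comm]
    exact hadd _ _
  have hN0 : 0 ≤ N 0 := le_ciInf fun y => by simpa using hneg y y.2
  obtain ⟨g, -, hg⟩ := exists_extension_of_le_sublinear (⟨⊥, 0⟩ : E →ₗ.[ℝ] ℝ) N hN_smul hN_add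
    (by
      rintro ⟨x, hx⟩
      obtain rfl : x = 0 := by simpa using hx
      simpa using hN0)
  refine ⟨g, fun x => (hg x).trans ?_, fun y hy => (hg y).trans ?_⟩
  · simpa using hN_le x 0 h0C
  · simpa [hp0] using hN_le y y hy

section L1Dual

variable {Ω : Type*} [MeasurableSpace Ω] {μ : Measure Ω} [IsFiniteMeasure μ]

theorem ContinuousLinearMap.hasSum_indicatorConstLp_iUnion (φ : Lp ℝ 1 μ →L[ℝ] ℝ)
    {s : ℕ → Set Ω} (hs : ∀ i, MeasurableSet (s i)) (hd : Pairwise (Function.onFun Disjoint s))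
    (hφ : ∀ i, 0 ≤ φ (indicatorConstLp 1 (hs i) (measure_ne_top μ _) 1)) :
    HasSum (fun i => φ (indicatorConstLp 1 (hs i) (measure_ne_top μ _) 1))
      (φ (indicatorConstLp 1 (MeasurableSet.iUnion hs) (measure_ne_top μ _) 1)) := by
  have hacc : ∀ n, MeasurableSet (⋃ i ∈ Finset.range n, s i) := fun n =>
    Finset.measurableSet_biUnion _ fun i _ => hs i
  have hsum : ∀ n, ∑ i ∈ Finset.range n, φ (indicatorConstLp 1 (hs i) (measure_ne_top μ _) 1) =
      φ (indicatorConstLp 1 (hacc n) (measure_ne_top μ _) 1) := fun n => by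
    induction n with
    | zero => simp
    | succ n ih =>
      have hdisj : Disjoint (⋃ i ∈ Finset.range n, s i) (s n) := by
        simp only [Set.disjoint_iUnion_left, Finset.mem_range]
        exact fun i hi => hd hi.ne
      rw [Finset.sum_range_succ, ih, ← map_add, ← indicatorConstLp_disjoint_union _ _ _ _ hdisj]
      congr 2
      rw [Finset.range_add_one, Finset.set_biUnion_insert, Set.union_comm]
  rw [hasSum_iff_tendsto_nat_of_nonneg hφ]
  simp only [hsum]
  refine (φ.continuous.tendsto _).comp (tendsto_indicatorConstLp_set ENNReal.one_ne_top ?_)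
  have hsub : ∀ n, (⋃ i ∈ Finset.range n, s i) ⊆ ⋃ i, s i := fun n =>
    Set.iUnion₂_subset fun i _ => Set.subset_iUnion s i
  have hanti : Antitone fun n => (⋃ i, s i) \ ⋃ i ∈ Finset.range n, s i := fun m n hmn =>
    Set.sdiff_subset_sdiff_right
      (Set.biUnion_subset_biUnion_left fun i hi => Finset.range_mono hmn hi)
  have hempty : ⋂ n, ((⋃ i, s i) \ ⋃ i ∈ Finset.range n, s i) = ∅ := by
    rw [← Set.sdiff_iUnion, Set.sdiff_eq_empty]
    exact Set.iUnion_subset fun i => Set.subset_iUnion_of_subset (i + 1)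
      (Set.subset_biUnion_of_mem (u := s) (Finset.mem_coe.2 (Finset.self_mem_range_succ i)))
  have hlim := tendsto_measure_iInter_atTop (μ := μ)
    (fun n => ((MeasurableSet.iUnion hs).diff (hacc n)).nullMeasurableSet) hanti
    ⟨0, measure_ne_top μ _⟩
  rw [hempty, measure_empty] at hlim
  refine hlim.congr fun n => ?_
  rw [Function.comp_apply, symmDiff_of_le (hsub n)]

/-- A positive continuous linear functional on `L¹(μ)` is integration against a measure. -/
theorem ContinuousLinearMap.exists_measure_integral_eq (φ : Lp ℝ 1 μ →L[ℝ] ℝ)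
    (hφ : ∀ s (hs : MeasurableSet s), 0 ≤ φ (indicatorConstLp 1 hs (measure_ne_top μ _) 1)) :
    ∃ ν : Measure Ω,
      (∀ s (hs : MeasurableSet s),
        ν s = ENNReal.ofReal (φ (indicatorConstLp 1 hs (measure_ne_top μ _) 1))) ∧
      ν ≤ ENNReal.ofReal ‖φ‖ • μ ∧
      ∀ f : Lp ℝ 1 μ, ∫ ω, f ω ∂ν = φ f := by
  let ν : Measure Ω := Measure.ofMeasurable
    (fun s hs => ENNReal.ofReal (φ (indicatorConstLp 1 hs (measure_ne_top μ _) 1)))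
    (by simp)
    (fun s hs hd => by
      have h := φ.hasSum_indicatorConstLp_iUnion hs hd fun i => hφ _ (hs i)
      rw [← h.tsum_eq, ENNReal.ofReal_tsum_of_nonneg (fun i => hφ _ (hs i)) h.summable])
  have hν : ∀ s (hs : MeasurableSet s),
      ν s = ENNReal.ofReal (φ (indicatorConstLp 1 hs (measure_ne_top μ _) 1)) :=
    fun s hs => Measure.ofMeasurable_apply s hs
  have hle : ν ≤ ENNReal.ofReal ‖φ‖ • μ := by
    refine Measure.le_iff.2 fun s hs => ?_
    rw [hν s hs, Measure.smul_apply, smul_eq_mul, ← ofReal_measureReal (measure_ne_top μ s),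
      ← ENNReal.ofReal_mul (norm_nonneg _)]
    refine ENNReal.ofReal_le_ofReal ((le_abs_self _).trans ((φ.le_opNorm _).trans_eq ?_))
    rw [norm_indicatorConstLp one_ne_zero ENNReal.one_ne_top]
    simp
  have hac : ν ≪ μ := Measure.absolutelyContinuous_of_le_smul hle
  have hint : ∀ f : Lp ℝ 1 μ, Integrable f ν := fun f =>
    Integrable.of_measure_le_smul ENNReal.ofReal_ne_top hle (L1.integrable_coeFn f)
  refine ⟨ν, hν, hle, fun f => ?_⟩
  refine Lp.induction ENNReal.one_ne_top (fun f : Lp ℝ 1 μ => ∫ ω, f ω ∂ν = φ f) ?_ ?_ ?_ f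
  · intro c s hs hμs
    rw [Lp.simpleFunc.coe_indicatorConst, integral_congr_ae (hac.ae_le indicatorConstLp_coeFn),
      integral_indicator_const c hs, measureReal_def, hν s hs, ENNReal.toReal_ofReal (hφ s hs)]
    have : indicatorConstLp 1 hs hμs.ne c =
        c • indicatorConstLp 1 hs (measure_ne_top μ s) (1 : ℝ) := by
      ext1
      filter_upwards [indicatorConstLp_coeFn (p := 1) (hs := hs) (hμs := hμs.ne) (c := c),
        indicatorConstLp_coeFn (p := 1) (hs := hs) (hμs := hμs.ne) (c := (1 : ℝ)),
        Lp.coeFn_smul c (indicatorConstLp 1 hs (measure_ne_top μ s) (1 : ℝ))] with ω h1 h2 h3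
      rw [h1, h3, Pi.smul_apply, h2]
      by_cases h : ω ∈ s <;> simp [h]
    rw [this, map_smul, smul_eq_mul, smul_eq_mul, mul_comm]
  · intro f g hf hg _ h1 h2
    rw [map_add, ← h1, ← h2, ← integral_add (hint _) (hint _)]
    exact integral_congr_ae (hac.ae_le (Lp.coeFn_add _ _))
  · refine isClosed_eq ?_ φ.continuous
    have h := continuous_integral.comp
      (continuous_L1_toL1 (G := ℝ) _ ENNReal.ofReal_ne_top hle)
    exact h.congr fun f => L1.integral_of_fun_eq_integral (hint f)

end L1Dual

/-- If every `X ∈ L` satisfies `E_μ(X) ≤ k * E_μ(X⁻)`, then there is a measure comparable to `μ`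
under which every `X ∈ L` has nonpositive integral. -/
theorem exists_measure_integral_nonpos_of_integral_le {Ω : Type*} [MeasurableSpace Ω]
    (μ : Measure Ω) [IsFiniteMeasure μ] (L : Set (Ω → ℝ)) (hL : L.Nonempty)
    (hLadd : ∀ X ∈ L, ∀ Y ∈ L, X + Y ∈ L)
    (hLsmul : ∀ X ∈ L, ∀ c : ℝ, 0 ≤ c → c • X ∈ L) {k : ℝ} (hk : 0 ≤ k)
    (hint : ∀ X ∈ L, Integrable X μ)
    (hle : ∀ X ∈ L, ∫ ω, X ω ∂μ ≤ k * ∫ ω, max (-(X ω)) 0 ∂μ) :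
    ∃ (ν : Measure Ω) (c : ENNReal), c ≠ ⊤ ∧ μ ≤ ν ∧ ν ≤ c • μ ∧
      ∀ X ∈ L, ∫ ω, X ω ∂ν ≤ 0 := by
  let p : Lp ℝ 1 μ → ℝ := fun f => ∫ ω, f ω ∂μ + k * ∫ ω, max (f ω) 0 ∂μ
  have hi : ∀ f : Lp ℝ 1 μ, Integrable f μ := L1.integrable_coeFn
  have hadd : ∀ f g, p (f + g) ≤ p f + p g := fun f g => by
    have h1 : ∫ ω, (f + g) ω ∂μ = ∫ ω, f ω ∂μ + ∫ ω, g ω ∂μ := by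
      rw [← integral_add (hi f) (hi g)]
      exact integral_congr_ae (Lp.coeFn_add f g)
    have h2 : ∫ ω, max ((f + g) ω) 0 ∂μ ≤ ∫ ω, max (f ω) 0 ∂μ + ∫ ω, max (g ω) 0 ∂μ := by
      rw [← integral_add (hi f).pos_part (hi g).pos_part]
      refine integral_mono_ae (hi _).pos_part ((hi f).pos_part.add (hi g).pos_part) ?_
      filter_upwards [Lp.coeFn_add f g] with ω h
      rw [h, Pi.add_apply]
      exact max_le (add_le_add (le_max_left _ _) (le_max_left _ _))
        (add_nonneg (le_max_right _ _) (le_max_right _ _))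
    simp only [p, h1]
    nlinarith [mul_le_mul_of_nonneg_left h2 hk]
  have hsmul : ∀ c : ℝ, 0 < c → ∀ f, p (c • f) = c * p f := fun c hc f => by
    have h1 : ∫ ω, (c • f) ω ∂μ = c * ∫ ω, f ω ∂μ := by
      rw [← integral_const_mul]
      exact integral_congr_ae (Lp.coeFn_smul c f)
    have h2 : ∫ ω, max ((c • f) ω) 0 ∂μ = c * ∫ ω, max (f ω) 0 ∂μ := by
      rw [← integral_const_mul]
      refine integral_congr_ae ?_
      filter_upwards [Lp.coeFn_smul c f] with ω h
      rw [h, Pi.smul_apply, smul_eq_mul, mul_max_of_nonneg _ _ hc.le, mul_zero]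
    simp only [p, h1, h2]
    ring
  let C : Set (Lp ℝ 1 μ) := {f | ∃ X ∈ L, f =ᵐ[μ] X}
  obtain ⟨g, hgp, hgC⟩ := exists_linearMap_le_sublinear_nonpos_on_cone p hsmul hadd C
    (by
      obtain ⟨X, hX⟩ := hL
      exact ⟨(hint X hX).toL1 X, X, hX, (hint X hX).coeFn_toL1⟩)
    (by
      rintro f ⟨X, hX, hfX⟩ g ⟨Y, hY, hgY⟩
      exact ⟨X + Y, hLadd X hX Y hY, (Lp.coeFn_add f g).trans (hfX.add hgY)⟩)
    (by
      rintro f ⟨X, hX, hfX⟩ c hc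
      exact ⟨c • X, hLsmul X hX c hc, (Lp.coeFn_smul c f).trans (hfX.const_smul c)⟩)
    (by
      rintro f ⟨X, hX, hfX⟩
      have hneg : (-f : Lp ℝ 1 μ) =ᵐ[μ] -X := (Lp.coeFn_neg f).trans hfX.neg
      have h1 : ∫ ω, (-f : Lp ℝ 1 μ) ω ∂μ = -∫ ω, X ω ∂μ := by
        rw [← integral_neg]
        exact integral_congr_ae hneg
      have h2 : ∫ ω, max ((-f : Lp ℝ 1 μ) ω) 0 ∂μ = ∫ ω, max (-(X ω)) 0 ∂μ :=
        integral_congr_ae (hneg.mono fun ω h => by simp only [h, Pi.neg_apply])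
      simp only [p, h1, h2]
      linarith [hle X hX])
  have hp_le : ∀ f, p f ≤ (1 + k) * ‖f‖ := fun f => by
    rw [L1.norm_eq_integral_norm, add_mul, one_mul]
    refine add_le_add (integral_mono (hi f) (hi f).norm fun ω => le_abs_self _)
      (mul_le_mul_of_nonneg_left ?_ hk)
    exact integral_mono (hi f).pos_part (hi f).norm fun ω => max_le (le_abs_self _) (abs_nonneg _)
  let φ : Lp ℝ 1 μ →L[ℝ] ℝ := g.mkContinuous (1 + k) fun f => by
    rw [Real.norm_eq_abs, abs_le']
    refine ⟨(hgp f).trans (hp_le f), ?_⟩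
    rw [← map_neg, ← norm_neg f]
    exact (hgp _).trans (hp_le _)
  have hφ : ∀ s (hs : MeasurableSet s),
      μ.real s ≤ φ (indicatorConstLp 1 hs (measure_ne_top μ _) 1) := fun s hs => by
    set f : Lp ℝ 1 μ := indicatorConstLp 1 hs (measure_ne_top μ _) 1
    have hf : (-f : Lp ℝ 1 μ) =ᵐ[μ] fun ω => -s.indicator (fun _ => (1 : ℝ)) ω :=
      (Lp.coeFn_neg f).trans indicatorConstLp_coeFn.neg
    have h1 : ∫ ω, (-f : Lp ℝ 1 μ) ω ∂μ = -μ.real s := by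
      rw [integral_congr_ae hf, integral_neg, integral_indicator_const _ hs, smul_eq_mul, mul_one]
    have h2 : ∫ ω, max ((-f : Lp ℝ 1 μ) ω) 0 ∂μ = 0 := by
      refine integral_eq_zero_of_ae (hf.mono fun ω h => ?_)
      simp only [h, Pi.zero_apply]
      exact max_eq_right (neg_nonpos.2 (Set.indicator_nonneg (fun _ _ => zero_le_one) ω))
    have h3 := hgp (-f)
    simp only [p, h1, h2, map_neg] at h3
    change μ.real s ≤ g f
    linarith
  obtain ⟨ν, hν, hνle, hνint⟩ :=
    φ.exists_measure_integral_eq fun s hs => measureReal_nonneg.trans (hφ s hs)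
  refine ⟨ν, _, ENNReal.ofReal_ne_top, Measure.le_iff.2 fun s hs => ?_, hνle, fun X hX => ?_⟩
  · rw [hν s hs, ← ofReal_measureReal (measure_ne_top μ s)]
    exact ENNReal.ofReal_le_ofReal (hφ s hs)
  · have hae := (hint X hX).coeFn_toL1
    rw [← integral_congr_ae ((Measure.absolutelyContinuous_of_le_smul hνle).ae_le hae), hνint]
    exact hgC _ ⟨X, hX, hae⟩

/-- **Theorem (FTAP, σ-additive version).**
Let `L` be a convex cone of real random variables on `(Ω, 𝒜, P₀)`.
There exists an equivalent super-martingale measure (ESM) for `L` if and only if there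
exist a σ-additive probability measure `Q ~ P₀` and a constant `k ≥ 0` such that every
`X ∈ L` is `Q`-integrable and `E_Q(X) ≤ k·E_Q(X⁻)` for every `X ∈ L`. -/
theorem stmt_0 {Ω : Type*} [MeasurableSpace Ω] (P₀ : Measure Ω) [IsProbabilityMeasure P₀]
    (L : Set (Ω → ℝ)) (hLmeas : ∀ X ∈ L, Measurable X)
    (hLadd : ∀ X ∈ L, ∀ Y ∈ L, X + Y ∈ L)
    (hLsmul : ∀ X ∈ L, ∀ c : ℝ, 0 ≤ c → c • X ∈ L) :
    (∃ P : Measure Ω, IsProbabilityMeasure P ∧ P ≪ P₀ ∧ P₀ ≪ P ∧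
      (∀ X ∈ L, Integrable X P) ∧ (∀ X ∈ L, ∫ ω, X ω ∂P ≤ 0)) ↔
    (∃ (Q : Measure Ω) (k : ℝ), IsProbabilityMeasure Q ∧ Q ≪ P₀ ∧ P₀ ≪ Q ∧ 0 ≤ k ∧
      (∀ X ∈ L, Integrable X Q) ∧
      (∀ X ∈ L, ∫ ω, X ω ∂Q ≤ k * ∫ ω, max (-(X ω)) 0 ∂Q)) := by
  constructor
  · rintro ⟨P, hP, hPP₀, hP₀P, hint, hle⟩
    exact ⟨P, 0, hP, hPP₀, hP₀P, le_rfl, hint, fun X hX => by simpa using hle X hX⟩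
  · rintro ⟨Q, k, hQ, hQP₀, hP₀Q, hk, hint, hle⟩
    obtain rfl | hL := L.eq_empty_or_nonempty
    · exact ⟨Q, hQ, hQP₀, hP₀Q, by simp, by simp⟩
    obtain ⟨ν, c, hc, hQν, hνQ, hν⟩ :=
      exists_measure_integral_nonpos_of_integral_le Q L hL hLadd hLsmul hk hint hle
    have hfin : IsFiniteMeasure ν :=
      ⟨(hνQ Set.univ).trans_lt (by simpa using hc.lt_top)⟩
    have hne : ν Set.univ ≠ 0 := fun h => by
      have := hQν Set.univ
      simp [h] at this
    have : NeZero ν := ⟨fun h => hne (by simp [h])⟩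
    have hinv : (ν Set.univ)⁻¹ ≠ 0 := ENNReal.inv_ne_zero.2 (measure_ne_top ν _)
    refine ⟨(ν Set.univ)⁻¹ • ν, isProbabilityMeasureSMul, ?_, ?_, fun X hX => ?_, fun X hX => ?_⟩
    · exact ((Measure.absolutelyContinuous_of_le_smul hνQ).trans hQP₀).smul_left _
    · exact (hP₀Q.trans (Measure.absolutelyContinuous_of_le hQν)).trans
        (Measure.absolutelyContinuous_smul hinv)
    · exact ((hint X hX).of_measure_le_smul hc hνQ).smul_measure (ENNReal.inv_ne_top.2 hne)
    · rw [integral_smul_measure]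
      exact smul_nonpos_of_nonneg_of_nonpos ENNReal.toReal_nonneg (hν X hX)
end

section
/- Let L be a convex cone of real random variables on (Ω, 𝒜, P₀). There exist an equivalent super-martingale measure (ESM) P for L and constants 0 < r ≤ s such that r·P₀(A) ≤ P(A) ≤ s·P₀(A) for all A ∈ 𝒜 if and only if every X ∈ L is P₀-integrable and there is a constant k ≥ 0 with E_{P₀}(X) ≤ k·E_{P₀}(X⁻) for every X ∈ L. -/
open MeasureTheory Filter Topology

/-- A sublinear functional that is nonnegative on `-K`, for a convex cone `K`, dominates a linear
functional that is nonpositive on `K`. -/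
theorem exists_linearMap_le_sublinear_nonpos_on_cone_s1 {E : Type*} [AddCommGroup E] [Module ℝ E]
    (p : E → ℝ) (p_hom : ∀ c : ℝ, 0 < c → ∀ x, p (c • x) = c * p x)
    (p_add : ∀ x y, p (x + y) ≤ p x + p y) (K : Set E) (K_zero : (0 : E) ∈ K)
    (K_add : ∀ x ∈ K, ∀ y ∈ K, x + y ∈ K) (K_smul : ∀ x ∈ K, ∀ c : ℝ, 0 ≤ c → c • x ∈ K)
    (hp : ∀ x ∈ K, 0 ≤ p (-x)) :
    ∃ φ : E →ₗ[ℝ] ℝ, (∀ x, φ x ≤ p x) ∧ ∀ x ∈ K, φ x ≤ 0 := by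
  have p_zero : p 0 = 0 := by
    have := p_hom 2 (by norm_num) 0
    rw [smul_zero] at this
    linarith
  have lower : ∀ y, ∀ x ∈ K, -p (-y) ≤ p (y - x) := by
    intro y x hx
    have h1 := p_add (y - x) (-y)
    have h2 := hp x hx
    rw [show y - x + -y = -x by abel] at h1
    linarith
  have bdd : ∀ y, BddBelow (Set.range fun x : K => p (y - x)) := fun y =>
    ⟨-p (-y), by rintro _ ⟨x, rfl⟩; exact lower y x x.2⟩
  have : Nonempty K := ⟨⟨0, K_zero⟩⟩
  let q : E → ℝ := fun y => ⨅ x : K, p (y - x)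
  have q_le : ∀ y, ∀ x ∈ K, q y ≤ p (y - x) := fun y x hx => ciInf_le (bdd y) ⟨x, hx⟩
  have q_hom_le : ∀ c : ℝ, 0 < c → ∀ y, q (c • y) ≤ c * q y := by
    intro c hc y
    rw [← div_le_iff₀' hc]
    refine le_ciInf fun x => ?_
    rw [div_le_iff₀' hc, ← p_hom c hc, smul_sub]
    exact q_le _ _ (K_smul x x.2 c hc.le)
  obtain ⟨φ, -, hφ⟩ := exists_extension_of_le_sublinear (⊥ : E →ₗ.[ℝ] ℝ) q
    (fun c hc y => by
      refine le_antisymm (q_hom_le c hc y) ?_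
      have := q_hom_le c⁻¹ (inv_pos.2 hc) (c • y)
      rwa [inv_smul_smul₀ hc.ne', inv_mul_eq_div, le_div_iff₀' hc] at this)
    (fun x y => by
      refine le_ciInf_add_ciInf fun a b => ?_
      refine (q_le _ _ (K_add a a.2 b b.2)).trans ?_
      rw [add_sub_add_comm]
      exact p_add _ _)
    (by
      rintro ⟨x, hx⟩
      obtain rfl : x = 0 := (Submodule.mem_bot ℝ).1 hx
      have h0 : (⊥ : E →ₗ.[ℝ] ℝ) ⟨0, hx⟩ = 0 := LinearPMap.map_zero _
      rw [h0]
      refine le_ciInf fun a => ?_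
      simpa using hp a a.2)
  refine ⟨φ, fun x => (hφ x).trans (by simpa using q_le x 0 K_zero), fun x hx => ?_⟩
  refine (hφ x).trans ((q_le x x hx).trans ?_)
  rw [sub_self, p_zero]

/-- A linear functional on `L¹` dominated by `Y ↦ E Y + k * E Y⁺` is integration against a density
with values in `[1, 1 + k]`. -/
theorem exists_density_of_le_integral_add_posPart {Ω : Type*} [MeasurableSpace Ω]
    (μ : Measure Ω) [IsProbabilityMeasure μ] (k : ℝ) (hk : 0 ≤ k) (φ : Lp ℝ 1 μ →ₗ[ℝ] ℝ)
    (hφ : ∀ Y : Lp ℝ 1 μ, φ Y ≤ ∫ ω, Y ω ∂μ + k * ∫ ω, max (Y ω) 0 ∂μ) :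
    ∃ f : Ω → ℝ, Measurable f ∧ (∀ ω, 1 ≤ f ω ∧ f ω ≤ 1 + k) ∧
      ∀ Y : Lp ℝ 1 μ, φ Y = ∫ ω, f ω * Y ω ∂μ := by
  have int1 : ∀ Y : Lp ℝ 1 μ, Integrable Y μ := fun Y => L1.integrable_coeFn Y
  have upper : ∀ Y : Lp ℝ 1 μ, φ Y ≤ (1 + k) * ‖Y‖ := by
    intro Y
    have h1 : ∫ ω, Y ω ∂μ ≤ ∫ ω, ‖Y ω‖ ∂μ :=
      integral_mono (int1 Y) (int1 Y).norm fun ω => le_abs_self _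
    have h2 : ∫ ω, max (Y ω) 0 ∂μ ≤ ∫ ω, ‖Y ω‖ ∂μ :=
      integral_mono (int1 Y).pos_part (int1 Y).norm
        fun ω => max_le (le_abs_self _) (abs_nonneg _)
    rw [L1.norm_eq_integral_norm]
    nlinarith [hφ Y]
  have bound : ∀ Y : Lp ℝ 1 μ, ‖φ Y‖ ≤ (1 + k) * ‖Y‖ := by
    intro Y
    rw [Real.norm_eq_abs, abs_le]
    have := upper (-Y)
    rw [map_neg, norm_neg] at this
    exact ⟨by linarith, upper Y⟩
  have φ_cont : Continuous φ := AddMonoidHomClass.continuous_of_bound φ _ bound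
  have hle : Lp ℝ 2 μ ≤ Lp ℝ 1 μ := Lp.antitone (by norm_num)
  let ι : Lp ℝ 2 μ →ₗ[ℝ] Lp ℝ 1 μ :=
    { toFun := fun g => ⟨g.1, hle g.2⟩
      map_add' := fun _ _ => rfl
      map_smul' := fun _ _ => rfl }
  have ι_norm : ∀ g, ‖ι g‖ ≤ ‖g‖ := by
    intro g
    rw [Lp.norm_def, Lp.norm_def]
    exact ENNReal.toReal_mono (Lp.eLpNorm_ne_top g)
      (eLpNorm_le_eLpNorm_of_exponent_le (by norm_num) (Lp.aestronglyMeasurable g))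
  let T : StrongDual ℝ (Lp ℝ 2 μ) := (φ ∘ₗ ι).mkContinuous (1 + k) fun g =>
    (bound _).trans (mul_le_mul_of_nonneg_left (ι_norm g) (by linarith))
  let F : Lp ℝ 2 μ := (InnerProductSpace.toDual ℝ (Lp ℝ 2 μ)).symm T
  have F_int : Integrable F μ := (Lp.memLp F).integrable (by norm_num)
  have hF : ∀ s, ∀ hs : MeasurableSet s,
      φ (indicatorConstLp 1 hs (measure_ne_top μ s) (1 : ℝ)) = ∫ ω in s, F ω ∂μ := by
    intro s hs
    have h1 : T (indicatorConstLp 2 hs (measure_ne_top μ s) (1 : ℝ)) = ∫ ω in s, F ω ∂μ := by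
      rw [← L2.inner_indicatorConstLp_one hs (measure_ne_top μ s) F, real_inner_comm]
      exact (InnerProductSpace.toDual_symm_apply).symm
    exact h1
  have ind_coe : ∀ (c : ℝ) (s : Set Ω) (hs : MeasurableSet s),
      indicatorConstLp 1 hs (measure_ne_top μ s) c =ᵐ[μ] s.indicator fun _ => c :=
    fun c s hs => indicatorConstLp_coeFn
  have F_le : F ≤ᵐ[μ] fun _ => 1 + k := by
    refine ae_le_of_forall_setIntegral_le F_int (integrable_const _) fun s hs _ => ?_
    have := hφ (indicatorConstLp 1 hs (measure_ne_top μ s) (1 : ℝ))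
    have e1 : ∫ ω, (indicatorConstLp 1 hs (measure_ne_top μ s) (1 : ℝ) : Ω → ℝ) ω ∂μ
        = μ.real s := by
      rw [integral_congr_ae (ind_coe 1 s hs), integral_indicator_const _ hs]; simp
    have e2 : ∫ ω, max ((indicatorConstLp 1 hs (measure_ne_top μ s) (1 : ℝ) : Ω → ℝ) ω) 0 ∂μ
        = μ.real s := by
      rw [← e1]
      refine integral_congr_ae ?_
      filter_upwards [ind_coe 1 s hs] with ω hω
      rw [hω]
      exact max_eq_left (Set.indicator_nonneg (fun _ _ => zero_le_one) ω)
    rw [e1, e2, hF s hs] at this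
    simp only [integral_const, measureReal_restrict_apply_univ, smul_eq_mul]
    linarith
  have le_F : (fun _ => 1) ≤ᵐ[μ] F := by
    refine ae_le_of_forall_setIntegral_le (integrable_const _) F_int fun s hs _ => ?_
    have := hφ (-indicatorConstLp 1 hs (measure_ne_top μ s) (1 : ℝ))
    have e0 : (-indicatorConstLp 1 hs (measure_ne_top μ s) (1 : ℝ) : Lp ℝ 1 μ) =ᵐ[μ]
        fun ω => -s.indicator (fun _ => (1 : ℝ)) ω := by
      filter_upwards [Lp.coeFn_neg (indicatorConstLp 1 hs (measure_ne_top μ s) (1 : ℝ)),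
        ind_coe 1 s hs] with ω h1 h2
      rw [h1, Pi.neg_apply, h2]
    have e1 : ∫ ω, (-indicatorConstLp 1 hs (measure_ne_top μ s) (1 : ℝ) : Lp ℝ 1 μ) ω ∂μ
        = -μ.real s := by
      rw [integral_congr_ae e0, integral_neg, integral_indicator_const _ hs]; simp
    have e2 : ∫ ω, max ((-indicatorConstLp 1 hs (measure_ne_top μ s) (1 : ℝ) : Lp ℝ 1 μ) ω) 0 ∂μ
        = 0 := by
      refine integral_eq_zero_of_ae ?_
      filter_upwards [e0] with ω hω
      rw [hω]
      exact max_eq_right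
        (neg_nonpos.2 (Set.indicator_nonneg (fun _ _ => zero_le_one) ω))
    rw [e1, e2, map_neg, hF s hs] at this
    simp only [integral_const, measureReal_restrict_apply_univ, smul_eq_mul]
    linarith
  have F_meas : Measurable F := (Lp.stronglyMeasurable F).measurable
  let f : Ω → ℝ := fun ω => max 1 (min (F ω) (1 + k))
  have f_meas : Measurable f := measurable_const.max (F_meas.min measurable_const)
  have f_bd : ∀ ω, 1 ≤ f ω ∧ f ω ≤ 1 + k := fun ω =>
    ⟨le_max_left _ _, max_le (by linarith) (min_le_right _ _)⟩
  have f_eq : f =ᵐ[μ] F := by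
    filter_upwards [F_le, le_F] with ω h1 h2
    simp only [f]
    rw [min_eq_left h1, max_eq_right h2]
  have f_abs : ∀ ω, ‖f ω‖ ≤ 1 + k := fun ω => by
    rw [Real.norm_eq_abs, abs_of_nonneg (by linarith [(f_bd ω).1])]
    exact (f_bd ω).2
  have prod_int : ∀ Y : Lp ℝ 1 μ, Integrable (fun ω => f ω * Y ω) μ := fun Y =>
    (int1 Y).bdd_mul f_meas.aestronglyMeasurable (ae_of_all _ f_abs)
  let ψ : Lp ℝ 1 μ →ₗ[ℝ] ℝ :=
    { toFun := fun Y => ∫ ω, f ω * Y ω ∂μ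
      map_add' := fun Y Z => by
        rw [← integral_add (prod_int Y) (prod_int Z)]
        refine integral_congr_ae ?_
        filter_upwards [Lp.coeFn_add Y Z] with ω hω
        rw [hω, Pi.add_apply, mul_add]
      map_smul' := fun c Y => by
        rw [RingHom.id_apply, smul_eq_mul, ← integral_const_mul]
        refine integral_congr_ae ?_
        filter_upwards [Lp.coeFn_smul c Y] with ω hω
        rw [hω, Pi.smul_apply, smul_eq_mul, mul_left_comm] }
  have ψ_cont : Continuous ψ := by
    refine AddMonoidHomClass.continuous_of_bound ψ (1 + k) fun Y => ?_
    refine (norm_integral_le_integral_norm _).trans ?_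
    rw [L1.norm_eq_integral_norm, ← integral_const_mul]
    refine integral_mono (prod_int Y).norm ((int1 Y).norm.const_mul _) fun ω => ?_
    simp only [norm_mul]
    exact mul_le_mul_of_nonneg_right (f_abs ω) (norm_nonneg _)
  refine ⟨f, f_meas, f_bd, fun Y => ?_⟩
  change φ Y = ψ Y
  refine Lp.induction (p := 1) ENNReal.one_ne_top (fun Y : Lp ℝ 1 μ => φ Y = ψ Y) ?_ ?_
    (isClosed_eq φ_cont ψ_cont) Y
  · intro c s hs hμs
    have hc : (Lp.simpleFunc.indicatorConst 1 hs hμs.ne c : Lp ℝ 1 μ)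
        = c • indicatorConstLp 1 hs (measure_ne_top μ s) (1 : ℝ) := by
      rw [Lp.simpleFunc.coe_indicatorConst]
      ext1
      filter_upwards [ind_coe c s hs, ind_coe 1 s hs,
        Lp.coeFn_smul c (indicatorConstLp 1 hs (measure_ne_top μ s) (1 : ℝ))] with ω h1 h2 h3
      rw [h1, h3, Pi.smul_apply, h2]
      by_cases hω : ω ∈ s <;> simp [hω]
    rw [hc, map_smul, map_smul, hF s hs, ← integral_indicator hs]
    congr 1
    refine integral_congr_ae ?_
    filter_upwards [f_eq, ind_coe 1 s hs] with ω h1 h2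
    rw [h2, h1]
    by_cases hω : ω ∈ s <;> simp [hω]
  · intro g h hg hh _ h1 h2
    rw [map_add, map_add, h1, h2]

/-- If every element of a convex cone `L` of random variables is integrable and satisfies
`E X ≤ k * E X⁻`, then some density with values in `[1, 1 + k]` makes every expectation on `L`
nonpositive. -/
theorem exists_density_integral_nonpos {Ω : Type*} [MeasurableSpace Ω] (μ : Measure Ω)
    [IsProbabilityMeasure μ] (L : Set (Ω → ℝ))
    (hLadd : ∀ X ∈ L, ∀ Y ∈ L, X + Y ∈ L)
    (hLsmul : ∀ X ∈ L, ∀ c : ℝ, 0 ≤ c → c • X ∈ L)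
    (hint : ∀ X ∈ L, Integrable X μ) (k : ℝ) (hk : 0 ≤ k)
    (hle : ∀ X ∈ L, ∫ ω, X ω ∂μ ≤ k * ∫ ω, max (-(X ω)) 0 ∂μ) :
    ∃ f : Ω → ℝ, Measurable f ∧ (∀ ω, 1 ≤ f ω ∧ f ω ≤ 1 + k) ∧
      ∀ X ∈ L, ∫ ω, f ω * X ω ∂μ ≤ 0 := by
  rcases L.eq_empty_or_nonempty with rfl | ⟨X₀, hX₀⟩
  · exact ⟨fun _ => 1, measurable_const, fun _ => ⟨le_rfl, by linarith⟩, by simp⟩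
  have int1 : ∀ Y : Lp ℝ 1 μ, Integrable Y μ := fun Y => L1.integrable_coeFn Y
  obtain ⟨φ, hφ, hφK⟩ := exists_linearMap_le_sublinear_nonpos_on_cone_s1
    (fun Y : Lp ℝ 1 μ => ∫ ω, Y ω ∂μ + k * ∫ ω, max (Y ω) 0 ∂μ)
    (fun c hc Y => by
      have e1 : ∫ ω, (c • Y) ω ∂μ = c * ∫ ω, Y ω ∂μ := by
        rw [← integral_const_mul]
        refine integral_congr_ae ?_
        filter_upwards [Lp.coeFn_smul c Y] with ω hω
        rw [hω, Pi.smul_apply, smul_eq_mul]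
      have e2 : ∫ ω, max ((c • Y) ω) 0 ∂μ = c * ∫ ω, max (Y ω) 0 ∂μ := by
        rw [← integral_const_mul]
        refine integral_congr_ae ?_
        filter_upwards [Lp.coeFn_smul c Y] with ω hω
        rw [hω, Pi.smul_apply, smul_eq_mul, mul_max_of_nonneg _ _ hc.le, mul_zero]
      simp only [e1, e2]
      ring)
    (fun Y Z => by
      have e1 : ∫ ω, (Y + Z) ω ∂μ = ∫ ω, Y ω ∂μ + ∫ ω, Z ω ∂μ := by
        rw [← integral_add (int1 Y) (int1 Z)]
        exact integral_congr_ae (Lp.coeFn_add Y Z)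
      have e2 : ∫ ω, max ((Y + Z) ω) 0 ∂μ
          ≤ ∫ ω, max (Y ω) 0 ∂μ + ∫ ω, max (Z ω) 0 ∂μ := by
        rw [← integral_add (int1 Y).pos_part (int1 Z).pos_part]
        refine integral_mono_ae (int1 _).pos_part
          ((int1 Y).pos_part.add (int1 Z).pos_part) ?_
        filter_upwards [Lp.coeFn_add Y Z] with ω hω
        simp only [hω, Pi.add_apply]
        exact max_le (add_le_add (le_max_left _ _) (le_max_left _ _))
          (add_nonneg (le_max_right _ _) (le_max_right _ _))
      simp only [e1]
      nlinarith)
    {Y | ∃ X ∈ L, Y =ᵐ[μ] X}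
    ⟨(0 : ℝ) • X₀, hLsmul X₀ hX₀ 0 le_rfl, by rw [zero_smul]; exact Lp.coeFn_zero _ _ _⟩
    (by
      rintro Y ⟨X, hX, hYX⟩ Y' ⟨X', hX', hYX'⟩
      exact ⟨X + X', hLadd X hX X' hX', (Lp.coeFn_add Y Y').trans (hYX.add hYX')⟩)
    (by
      rintro Y ⟨X, hX, hYX⟩ c hc
      exact ⟨c • X, hLsmul X hX c hc, (Lp.coeFn_smul c Y).trans (hYX.const_smul c)⟩)
    (by
      rintro Y ⟨X, hX, hYX⟩
      have e : (-Y : Lp ℝ 1 μ) =ᵐ[μ] fun ω => -X ω := by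
        filter_upwards [Lp.coeFn_neg Y, hYX] with ω h1 h2
        rw [h1, Pi.neg_apply, h2]
      have e2 : ∫ ω, max ((-Y : Lp ℝ 1 μ) ω) 0 ∂μ = ∫ ω, max (-(X ω)) 0 ∂μ := by
        refine integral_congr_ae ?_
        filter_upwards [e] with ω hω
        rw [hω]
      simp only [e2, integral_congr_ae e, integral_neg]
      linarith [hle X hX])
  obtain ⟨f, f_meas, f_bd, hf⟩ := exists_density_of_le_integral_add_posPart μ k hk φ hφ
  refine ⟨f, f_meas, f_bd, fun X hX => ?_⟩
  have hX1 := (hint X hX).coeFn_toL1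
  have := hφK ((hint X hX).toL1 X) ⟨X, hX, hX1⟩
  rw [hf] at this
  refine (integral_congr_ae ?_).trans_le this
  filter_upwards [hX1] with ω hω
  rw [hω]

/-- **Theorem (FTAP, second part).**
There exist an ESM `P` for the convex cone `L` and constants `0 < r ≤ s` with
`r·P₀ ≤ P ≤ s·P₀` if and only if every `X ∈ L` is `P₀`-integrable and there is a
constant `k ≥ 0` with `E_{P₀}(X) ≤ k·E_{P₀}(X⁻)` for every `X ∈ L`. -/
theorem stmt_1 {Ω : Type*} [MeasurableSpace Ω] (P₀ : Measure Ω) [IsProbabilityMeasure P₀]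
    (L : Set (Ω → ℝ)) (hLmeas : ∀ X ∈ L, Measurable X)
    (hLadd : ∀ X ∈ L, ∀ Y ∈ L, X + Y ∈ L)
    (hLsmul : ∀ X ∈ L, ∀ c : ℝ, 0 ≤ c → c • X ∈ L) :
    (∃ (P : Measure Ω) (r s : ℝ), IsProbabilityMeasure P ∧ P ≪ P₀ ∧ P₀ ≪ P ∧
      (∀ X ∈ L, Integrable X P) ∧ (∀ X ∈ L, ∫ ω, X ω ∂P ≤ 0) ∧
      0 < r ∧ r ≤ s ∧
      (∀ A : Set Ω, MeasurableSet A →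
        ENNReal.ofReal r * P₀ A ≤ P A ∧ P A ≤ ENNReal.ofReal s * P₀ A)) ↔
    ((∀ X ∈ L, Integrable X P₀) ∧
      ∃ k : ℝ, 0 ≤ k ∧ ∀ X ∈ L, ∫ ω, X ω ∂P₀ ≤ k * ∫ ω, max (-(X ω)) 0 ∂P₀) := by
  constructor
  · rintro ⟨P, r, s, -, -, -, hint, hneg, hr, hrs, hP⟩
    have hs : 0 < s := hr.trans_le hrs
    have h_lower : ENNReal.ofReal r • P₀ ≤ P := Measure.le_iff.2 fun A hA => (hP A hA).1
    have h_upper : P ≤ ENNReal.ofReal s • P₀ := Measure.le_iff.2 fun A hA => (hP A hA).2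
    have hint₀ : ∀ X ∈ L, Integrable X P₀ := fun X hX =>
      (integrable_smul_measure (by simpa using hr) ENNReal.ofReal_ne_top).1
        ((hint X hX).mono_measure h_lower)
    refine ⟨hint₀, s / r, by positivity, fun X hX => ?_⟩
    have split : ∀ μ : Measure Ω, Integrable X μ →
        ∫ ω, X ω ∂μ = ∫ ω, max (X ω) 0 ∂μ - ∫ ω, max (-(X ω)) 0 ∂μ := by
      intro μ h
      rw [← integral_sub h.pos_part h.neg_part]
      refine integral_congr_ae (ae_of_all _ fun ω => ?_)
      exact (max_zero_sub_max_neg_zero_eq_self (X ω)).symm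
    have h1 : r * ∫ ω, max (X ω) 0 ∂P₀ ≤ ∫ ω, max (X ω) 0 ∂P := by
      have := integral_mono_measure h_lower (ae_of_all _ fun ω => le_max_right (X ω) 0)
        (hint X hX).pos_part
      rwa [integral_smul_measure, ENNReal.toReal_ofReal hr.le, smul_eq_mul] at this
    have h2 : ∫ ω, max (-(X ω)) 0 ∂P ≤ s * ∫ ω, max (-(X ω)) 0 ∂P₀ := by
      have := integral_mono_measure h_upper (ae_of_all _ fun ω => le_max_right (-(X ω)) 0)
        ((hint₀ X hX).neg_part.smul_measure ENNReal.ofReal_ne_top)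
      rwa [integral_smul_measure, ENNReal.toReal_ofReal hs.le, smul_eq_mul] at this
    have h3 := hneg X hX
    rw [split P (hint X hX)] at h3
    have h4 : 0 ≤ ∫ ω, max (-(X ω)) 0 ∂P₀ := integral_nonneg fun ω => le_max_right _ _
    rw [split P₀ (hint₀ X hX), div_mul_eq_mul_div, le_div_iff₀ hr]
    nlinarith
  · rintro ⟨hint, k, hk, hle⟩
    obtain ⟨f, f_meas, f_bd, hf⟩ :=
      exists_density_integral_nonpos P₀ L hLadd hLsmul hint k hk hle
    have f_abs : ∀ ω, ‖f ω‖ ≤ 1 + k := fun ω => by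
      rw [Real.norm_eq_abs, abs_of_nonneg (by linarith [(f_bd ω).1])]
      exact (f_bd ω).2
    have f_int : Integrable f P₀ :=
      Integrable.of_bound f_meas.aestronglyMeasurable (1 + k) (ae_of_all _ f_abs)
    let c : ℝ := ∫ ω, f ω ∂P₀
    have hc1 : 1 ≤ c := by
      have := integral_mono (integrable_const (1 : ℝ)) f_int fun ω => (f_bd ω).1
      simpa using this
    have hc : 0 < c := by linarith
    let g : Ω → ENNReal := fun ω => ENNReal.ofReal (f ω / c)
    have g_meas : Measurable g := (f_meas.div_const c).ennreal_ofReal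
    have g_top : ∀ᵐ ω ∂P₀, g ω < ⊤ := ae_of_all _ fun ω => ENNReal.ofReal_lt_top
    have f_div_nonneg : ∀ ω, 0 ≤ f ω / c := fun ω =>
      div_nonneg (by linarith [(f_bd ω).1]) hc.le
    have g_toReal : ∀ ω, (g ω).toReal = f ω / c := fun ω =>
      ENNReal.toReal_ofReal (f_div_nonneg ω)
    have h_bounds : ∀ A : Set Ω, MeasurableSet A →
        ENNReal.ofReal (1 / c) * P₀ A ≤ P₀.withDensity g A ∧
          P₀.withDensity g A ≤ ENNReal.ofReal ((1 + k) / c) * P₀ A := by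
      intro A hA
      rw [withDensity_apply _ hA, ← setLIntegral_const, ← setLIntegral_const]
      exact ⟨lintegral_mono fun ω => ENNReal.ofReal_le_ofReal
          (div_le_div_of_nonneg_right (f_bd ω).1 hc.le),
        lintegral_mono fun ω => ENNReal.ofReal_le_ofReal
          (div_le_div_of_nonneg_right (f_bd ω).2 hc.le)⟩
    refine ⟨P₀.withDensity g, 1 / c, (1 + k) / c, ⟨?_⟩, withDensity_absolutelyContinuous _ _,
      withDensity_absolutelyContinuous' g_meas.aemeasurable ?_, fun X hX => ?_, fun X hX => ?_,
      by positivity, div_le_div_of_nonneg_right (by linarith) hc.le, h_bounds⟩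
    · rw [withDensity_apply _ MeasurableSet.univ, Measure.restrict_univ,
        ← ofReal_integral_eq_lintegral_ofReal (f_int.div_const c) (ae_of_all _ f_div_nonneg),
        integral_div, div_self hc.ne', ENNReal.ofReal_one]
    · refine ae_of_all _ fun ω => ?_
      have : 0 < f ω / c := div_pos (by linarith [(f_bd ω).1]) hc
      simpa [g] using this
    · rw [integrable_withDensity_iff_integrable_smul' g_meas g_top]
      simp only [g_toReal, smul_eq_mul, div_mul_eq_mul_div]
      exact ((hint X hX).bdd_mul f_meas.aestronglyMeasurable (ae_of_all _ f_abs)).div_const c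
    · rw [integral_withDensity_eq_integral_toReal_smul g_meas g_top]
      simp only [g_toReal, smul_eq_mul, div_mul_eq_mul_div, integral_div]
      exact div_nonpos_of_nonpos_of_nonneg (hf X hX) hc.le
end

section
/- Let Q be a σ-additive probability measure on (Ω, 𝒜), k ≥ 0 a constant, t = k + 1, and X : Ω → ℝ a Q-integrable random variable with E_Q(X) ≤ k·E_Q(X⁻). Define f = (1_{X ≥ 0} + t·1_{X < 0}) / (Q(X ≥ 0) + t·Q(X < 0)) (the denominator lies in [1, t], hence is strictly positive) and P(A) = E_Q[f·1_A] for A ∈ 𝒜. Then P is a σ-additive probability measure on 𝒜 satisfying (1/t)·Q(A) ≤ P(A) ≤ t·Q(A) for all A ∈ 𝒜, X is P-integrable, and E_P(X) ≤ 0. -/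
open MeasureTheory Filter Topology

/-- If `c ≤ f ≤ C`, the measure with density `f` lies between `c • Q` and `C • Q`. -/
lemma withDensity_ofReal_bounds {Ω : Type*} [MeasurableSpace Ω] (Q : Measure Ω)
    {f : Ω → ℝ} {c C : ℝ} (hc : ∀ ω, c ≤ f ω) (hC : ∀ ω, f ω ≤ C)
    {A : Set Ω} (hA : MeasurableSet A) :
    ENNReal.ofReal c * Q A ≤ Q.withDensity (fun ω => ENNReal.ofReal (f ω)) A ∧
      Q.withDensity (fun ω => ENNReal.ofReal (f ω)) A ≤ ENNReal.ofReal C * Q A := by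
  rw [withDensity_apply _ hA, ← setLIntegral_const, ← setLIntegral_const]
  exact ⟨lintegral_mono fun ω => ENNReal.ofReal_le_ofReal (hc ω),
    lintegral_mono fun ω => ENNReal.ofReal_le_ofReal (hC ω)⟩

/-- **One-variable step in the proof of the FTAP.**
Given a probability `Q`, `k ≥ 0`, `t = k + 1` and a `Q`-integrable `X` with
`E_Q(X) ≤ k·E_Q(X⁻)`, the measure `P` with density
`f = (1_{X ≥ 0} + t·1_{X < 0}) / (Q(X ≥ 0) + t·Q(X < 0))` with respect to `Q`
is a probability measure with `(1/t)·Q ≤ P ≤ t·Q`, `X` is `P`-integrable and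
`E_P(X) ≤ 0`. -/
theorem stmt_2 {Ω : Type*} [MeasurableSpace Ω] (Q : Measure Ω) [IsProbabilityMeasure Q]
    (k : ℝ) (hk : 0 ≤ k) (t : ℝ) (ht : t = k + 1)
    (X : Ω → ℝ) (hXmeas : Measurable X) (hXint : Integrable X Q)
    (hXineq : ∫ ω, X ω ∂Q ≤ k * ∫ ω, max (-(X ω)) 0 ∂Q)
    (f : Ω → ℝ)
    (hf : f = fun ω =>
      ((if 0 ≤ X ω then (1 : ℝ) else 0) + t * (if X ω < 0 then (1 : ℝ) else 0)) /
        ((Q {ω | 0 ≤ X ω}).toReal + t * (Q {ω | X ω < 0}).toReal))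
    (P : Measure Ω) (hP : P = Q.withDensity fun ω => ENNReal.ofReal (f ω)) :
    IsProbabilityMeasure P ∧
    (∀ A : Set Ω, MeasurableSet A →
      ENNReal.ofReal (1 / t) * Q A ≤ P A ∧ P A ≤ ENNReal.ofReal t * Q A) ∧
    Integrable X P ∧ ∫ ω, X ω ∂P ≤ 0 := by
  have hneg : MeasurableSet {ω | X ω < 0} := measurableSet_lt hXmeas measurable_const
  set b : ℝ := Q.real {ω | X ω < 0} with hb
  have hb0 : 0 ≤ b := measureReal_nonneg
  have hb1 : b ≤ 1 := measureReal_le_one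
  have hcompl : Q.real {ω | 0 ≤ X ω} = 1 - b := by
    rw [hb, ← probReal_compl_eq_one_sub hneg]
    congr 1
    ext ω
    simp
  set D : ℝ := 1 + k * b with hD
  have hD1 : 1 ≤ D := by nlinarith
  have hDt : D ≤ t := by nlinarith
  have hD0 : 0 < D := by linarith
  have ht0 : 0 < t := by linarith
  have hfω : ∀ ω, f ω = (1 + k * {ω | X ω < 0}.indicator (fun _ => (1 : ℝ)) ω) / D := by
    intro ω
    have hden : (Q {ω | 0 ≤ X ω}).toReal + t * (Q {ω | X ω < 0}).toReal = D := by
      change Q.real {ω | 0 ≤ X ω} + t * b = D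
      rw [hcompl, ht, hD]
      ring
    rw [hf]
    simp only [hden]
    congr 1
    by_cases h : X ω < 0
    · simp [h, ht, add_comm]
    · simp [h, not_lt.mp h]
  have hf_lower : ∀ ω, 1 / t ≤ f ω := by
    intro ω
    rw [hfω]
    have h0 : 0 ≤ {ω | X ω < 0}.indicator (fun _ => (1 : ℝ)) ω :=
      Set.indicator_nonneg (fun _ _ => zero_le_one) ω
    exact div_le_div₀ (by positivity) (by nlinarith) hD0 hDt
  have hf_upper : ∀ ω, f ω ≤ t := by
    intro ω
    rw [hfω, div_le_iff₀ hD0]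
    have h1 : {ω | X ω < 0}.indicator (fun _ => (1 : ℝ)) ω ≤ 1 :=
      Set.indicator_le_self' (fun _ _ => zero_le_one) ω
    nlinarith
  have hf0 : ∀ ω, 0 ≤ f ω := fun ω => (one_div_pos.mpr ht0).le.trans (hf_lower ω)
  have hfmeas : Measurable f := by
    rw [funext hfω]
    exact ((measurable_const.indicator hneg).const_mul k |>.const_add 1).div_const D
  have hind : Integrable ({ω | X ω < 0}.indicator (fun _ => (1 : ℝ))) Q :=
    (integrable_const 1).indicator hneg
  have hfint : ∫ ω, f ω ∂Q = 1 := by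
    simp_rw [hfω]
    rw [integral_div, integral_add (integrable_const 1) (hind.const_mul k), integral_const_mul,
      integral_indicator_const _ hneg]
    simp only [integral_const, probReal_univ, smul_eq_mul, mul_one]
    exact div_self hD0.ne'
  have hfi : Integrable f Q := by
    rw [funext hfω]
    exact ((integrable_const 1).add (hind.const_mul k)).div_const D
  have hofReal : Measurable fun ω => ENNReal.ofReal (f ω) := hfmeas.ennreal_ofReal
  have hfX : ∀ ω, f ω * X ω = (X ω - k * max (-(X ω)) 0) / D := by
    intro ω
    rw [hfω, div_mul_eq_mul_div]
    congr 1
    by_cases h : X ω < 0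
    · simp only [Set.indicator, Set.mem_ofPred_eq, h, if_true, max_eq_left (neg_pos.mpr h).le]
      ring
    · simp [h, not_lt.mp h]
  have hnegpart : Integrable (fun ω => k * max (-(X ω)) 0) Q := hXint.neg_part.const_mul k
  have hlt : ∀ᵐ ω ∂Q, ENNReal.ofReal (f ω) < ⊤ := ae_of_all _ fun _ => ENNReal.ofReal_lt_top
  subst hP
  refine ⟨⟨?_⟩, fun A hA => withDensity_ofReal_bounds Q hf_lower hf_upper hA, ?_, ?_⟩
  · rw [withDensity_apply _ MeasurableSet.univ, Measure.restrict_univ,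
      ← ofReal_integral_eq_lintegral_ofReal hfi (ae_of_all _ hf0), hfint, ENNReal.ofReal_one]
  · rw [integrable_withDensity_iff_integrable_smul' hofReal hlt]
    simp only [ENNReal.toReal_ofReal (hf0 _), smul_eq_mul, hfX]
    exact (hXint.sub hnegpart).div_const D
  · rw [integral_withDensity_eq_integral_toReal_smul hofReal hlt]
    simp only [ENNReal.toReal_ofReal (hf0 _), smul_eq_mul, hfX]
    rw [integral_div, integral_sub hXint hnegpart, integral_const_mul]
    exact div_nonpos_of_nonpos_of_nonneg (sub_nonpos.mpr hXineq) hD0.le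
end

section
/- Let L be a convex cone of real random variables on (Ω, 𝒜, P₀), Q a σ-additive probability measure on 𝒜, and k ≥ 0 a constant such that every X ∈ L is Q-integrable and E_Q(X) ≤ k·E_Q(X⁻) for every X ∈ L. Set t = k + 1. Then for every finite family X₁, …, Xₙ ∈ L there exists a σ-additive probability measure P on 𝒜 with (1/t)·Q(A) ≤ P(A) ≤ t·Q(A) for all A ∈ 𝒜 and E_P(X_j) ≤ 0 for every j = 1, …, n. -/
open MeasureTheory Filter Topology

open scoped ENNReal

section

variable {Ω : Type*} [MeasurableSpace Ω] {Q : Measure Ω}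

/-- Integration against a measure dominated by a multiple of `Q` is continuous on `L¹(Q)`. -/
lemma continuous_integral_of_le_smul {ν : Measure Ω} {C : ℝ} (hC : 0 ≤ C)
    (hν : ν ≤ ENNReal.ofReal C • Q) :
    Continuous fun f : Lp ℝ 1 Q ↦ ∫ ω, f ω ∂ν := by
  have hac : ν ≪ Q := (Measure.absolutelyContinuous_of_le hν).trans
    Measure.smul_absolutelyContinuous
  have hintQ (f : Lp ℝ 1 Q) : Integrable f (ENNReal.ofReal C • Q) :=
    (L1.integrable_coeFn f).smul_measure ENNReal.ofReal_ne_top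
  have hint (f : Lp ℝ 1 Q) : Integrable f ν := (hintQ f).mono_measure hν
  refine (LipschitzWith.of_dist_le_mul (K := C.toNNReal) fun f g ↦ ?_).continuous
  have hsub : ∫ ω, f ω ∂ν - ∫ ω, g ω ∂ν = ∫ ω, (f - g) ω ∂ν := by
    rw [← integral_sub (hint f) (hint g)]
    exact integral_congr_ae (hac.ae_le (Lp.coeFn_sub f g).symm)
  rw [dist_eq_norm, hsub, dist_eq_norm, Real.coe_toNNReal C hC]
  calc ‖∫ ω, (f - g) ω ∂ν‖ ≤ ∫ ω, ‖(f - g) ω‖ ∂ν := norm_integral_le_integral_norm _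
    _ ≤ ∫ ω, ‖(f - g) ω‖ ∂(ENNReal.ofReal C • Q) :=
      integral_mono_measure hν (ae_of_all _ fun _ ↦ norm_nonneg _) (hintQ _).norm
    _ = C * ‖f - g‖ := by
      rw [integral_smul_measure, ENNReal.toReal_ofReal hC, L1.norm_eq_integral_norm, smul_eq_mul]

/-- A continuous linear functional on `L¹(Q)` with `0 ≤ F 1_A ≤ C · Q(A)` is represented
by a measure. -/
lemma exists_measure_of_functional [IsFiniteMeasure Q] (F : Lp ℝ 1 Q →L[ℝ] ℝ) {C : ℝ}
    (hC : 0 ≤ C)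
    (h0 : ∀ A (hA : MeasurableSet A), 0 ≤ F (indicatorConstLp 1 hA (measure_ne_top Q A) 1))
    (hF : ∀ A (hA : MeasurableSet A),
      F (indicatorConstLp 1 hA (measure_ne_top Q A) 1) ≤ C * Q.real A) :
    ∃ ν : Measure Ω, (∀ A (hA : MeasurableSet A),
        ν A = ENNReal.ofReal (F (indicatorConstLp 1 hA (measure_ne_top Q A) 1))) ∧
      ∀ X (hX : Integrable X Q), Integrable X ν ∧ ∫ ω, X ω ∂ν = F hX.toL1 := by
  classical
  let m : Set Ω → ℝ := fun A ↦
    if hA : MeasurableSet A then F (indicatorConstLp 1 hA (measure_ne_top Q A) 1) else 0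
  have hm {A} (hA : MeasurableSet A) :
      m A = F (indicatorConstLp 1 hA (measure_ne_top Q A) 1) := dif_pos hA
  have hfin : IsFiniteMeasure (ENNReal.ofReal C • Q) := Q.smul_finite ENNReal.ofReal_ne_top
  have hofReal (A) : ENNReal.ofReal (C * Q.real A) = (ENNReal.ofReal C • Q) A := by
    rw [ENNReal.ofReal_mul hC, ofReal_measureReal, Measure.smul_apply, smul_eq_mul]
  let v : SignedMeasure Ω := VectorMeasure.of_additive_of_le_measure (μ := ENNReal.ofReal C • Q) m
    (fun A ↦ by
      by_cases hA : MeasurableSet A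
      · rw [hm hA, Real.enorm_of_nonneg (h0 A hA), ← hofReal]
        exact ENNReal.ofReal_le_ofReal (hF A hA)
      · simp [m, hA])
    (fun A B hA hB hAB ↦ by
      rw [hm hA, hm hB, hm (hA.union hB), ← map_add, ← indicatorConstLp_disjoint_union _ _ _ _ hAB])
    (fun A hA ↦ dif_neg hA)
  have hv0 : 0 ≤[Set.univ] v := by
    refine VectorMeasure.restrict_le_restrict_of_subset_le _ _ fun A hA _ ↦ ?_
    exact (h0 A hA).trans_eq (hm hA).symm
  let ν : Measure Ω := v.toMeasureOfZeroLE Set.univ .univ hv0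
  have hν (A) (hA : MeasurableSet A) :
      ν A = ENNReal.ofReal (F (indicatorConstLp 1 hA (measure_ne_top Q A) 1)) := by
    rw [SignedMeasure.toMeasureOfZeroLE_apply _ hv0 .univ hA, ENNReal.ofReal_eq_coe_nnreal (h0 A hA)]
    congr 2
    rw [Set.univ_inter]
    exact hm hA
  have hle : ν ≤ ENNReal.ofReal C • Q := Measure.le_iff.2 fun A hA ↦ by
    rw [hν A hA, ← hofReal]
    exact ENNReal.ofReal_le_ofReal (hF A hA)
  have hac : ν ≪ Q := (Measure.absolutelyContinuous_of_le hle).trans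
    Measure.smul_absolutelyContinuous
  have hint {X : Ω → ℝ} (hX : Integrable X Q) : Integrable X ν :=
    (hX.smul_measure ENNReal.ofReal_ne_top).mono_measure hle
  refine ⟨ν, hν, fun X hX ↦ ⟨hint hX, ?_⟩⟩
  suffices H : ∀ hX : Integrable X Q, ∫ ω, X ω ∂ν = F hX.toL1 from H hX
  refine hX.induction (P := fun X ↦ ∀ hX : Integrable X Q, ∫ ω, X ω ∂ν = F hX.toL1)
    ?_ ?_ ?_ ?_
  · intro c A hA _ hX
    have : hX.toL1 = c • indicatorConstLp 1 hA (measure_ne_top Q A) (1 : ℝ) := by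
      ext1
      filter_upwards [hX.coeFn_toL1,
        Lp.coeFn_smul c (indicatorConstLp 1 hA (measure_ne_top Q A) (1 : ℝ)),
        indicatorConstLp_coeFn (p := 1) (hs := hA) (hμs := measure_ne_top Q A) (c := (1 : ℝ))]
        with ω h1 h2 h3
      rw [h1, h2, Pi.smul_apply, h3]
      by_cases hω : ω ∈ A <;> simp [hω]
    rw [this, map_smul, integral_indicator_const c hA, measureReal_def, hν A hA,
      ENNReal.toReal_ofReal (h0 A hA), smul_eq_mul, smul_eq_mul, mul_comm]
  · intro f g _ hf hg ihf ihg hfg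
    rw [Integrable.toL1_add f g hf hg, map_add, ← ihf hf, ← ihg hg]
    exact integral_add (hint hf) (hint hg)
  · have : {f : Lp ℝ 1 Q | ∀ hX : Integrable f Q, ∫ ω, f ω ∂ν = F hX.toL1}
        = {f : Lp ℝ 1 Q | ∫ ω, f ω ∂ν = F f} := by
      ext f
      simp [L1.integrable_coeFn f]
    rw [this]
    exact isClosed_eq (continuous_integral_of_le_smul hC hle) F.continuous
  · intro f g hfg hf ih hg
    rw [← integral_congr_ae (hac.ae_le hfg), ih hf]
    exact congrArg F ((Integrable.toL1_eq_toL1_iff f g hf hg).2 hfg)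

/-- Hahn-Banach separation of the negative of a convex cone `K ⊆ L¹(Q)` from the open convex
cone of those `f` for which `(k + 1) · E(f⁺) < E(f⁻)`. -/
lemma exists_functional_nonpos [IsProbabilityMeasure Q] {k : ℝ} (hk : 0 ≤ k)
    (K : ConvexCone ℝ (Lp ℝ 1 Q)) (hK0 : 0 ∈ K)
    (hK : ∀ f ∈ K, (k + 2) * ∫ ω, f ω ∂Q ≤ k * ‖f‖) :
    ∃ F : Lp ℝ 1 Q →L[ℝ] ℝ,
      F (indicatorConstLp 1 .univ (measure_ne_top Q Set.univ) 1) = 1 ∧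
      (∀ A (hA : MeasurableSet A), 1 / (k + 1) * Q.real A ≤
          F (indicatorConstLp 1 hA (measure_ne_top Q A) 1) ∧
        F (indicatorConstLp 1 hA (measure_ne_top Q A) 1) ≤ (k + 1) * Q.real A) ∧
      ∀ f ∈ K, F f ≤ 0 := by
  let I : Lp ℝ 1 Q →L[ℝ] ℝ := L1.integralCLM
  have hI (f : Lp ℝ 1 Q) : I f = ∫ ω, f ω ∂Q := by
    rw [← L1.integral_eq_integral, L1.integral_eq]
  let p : Lp ℝ 1 Q → ℝ := fun f ↦ (k + 2) * I f + k * ‖f‖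
  have hpc : Continuous p := by fun_prop
  have hpadd (f g) : p (f + g) ≤ p f + p g := by
    have := mul_le_mul_of_nonneg_left (norm_add_le f g) hk
    simp only [p, map_add]
    linarith
  have hpsmul {c : ℝ} (hc : 0 ≤ c) (f) : p (c • f) = c * p f := by
    simp only [p, map_smul, norm_smul, Real.norm_of_nonneg hc, smul_eq_mul]
    ring
  have hUconv : Convex ℝ {f | p f < 0} := by
    refine convex_iff_forall_pos.2 fun f hf g hg a b ha hb _ ↦ ?_
    refine (hpadd _ _).trans_lt ?_
    rw [hpsmul ha.le, hpsmul hb.le]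
    exact add_neg (mul_neg_of_pos_of_neg ha hf) (mul_neg_of_pos_of_neg hb hg)
  have hdisj : Disjoint {f | p f < 0} (-(K : Set (Lp ℝ 1 Q))) := by
    refine Set.disjoint_left.2 fun f hf hfK ↦ ?_
    have := hK _ (Set.mem_neg.1 hfK)
    rw [← hI, map_neg, norm_neg] at this
    simp only [Set.mem_ofPred_eq, p] at hf
    linarith
  obtain ⟨F, u, hFu, huF⟩ := geometric_hahn_banach_open hUconv
    (isOpen_lt hpc continuous_const) K.convex.neg hdisj
  have hu : u ≤ 0 := by simpa using huF 0 (by simpa using hK0)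
  have hFneg {f} (hf : p f < 0) : F f < 0 := (hFu f hf).trans_le hu
  have hFK (f) (hf : f ∈ K) : F f ≤ 0 := by
    by_contra! hpos
    have hc : 0 < (1 - u) / F f := div_pos (by linarith) hpos
    have := huF (-(((1 - u) / F f) • f)) (by simpa using K.smul_mem hc hf)
    rw [map_neg, map_smul, smul_eq_mul, div_mul_cancel₀ _ hpos.ne'] at this
    linarith
  let J (A : Set Ω) (hA : MeasurableSet A) : Lp ℝ 1 Q :=
    indicatorConstLp 1 hA (measure_ne_top Q A) 1
  have hIJ (A hA) : I (J A hA) = Q.real A := by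
    rw [hI, integral_indicatorConstLp, smul_eq_mul, mul_one]
  have hnJ (A hA) : ‖J A hA‖ = Q.real A := by
    simp [J, norm_indicatorConstLp]
  have hpJ (A hA) : p (J A hA) = 2 * (k + 1) * Q.real A := by
    simp only [p, hIJ, hnJ]; ring
  have hpJneg (A hA) : p (-J A hA) = -(2 * Q.real A) := by
    simp only [p, map_neg, norm_neg, hIJ, hnJ]; ring
  set e := F (J Set.univ .univ) with he
  have hepos : 0 < e := by
    have := hFneg (f := -J Set.univ .univ) (by rw [hpJneg]; simp)
    rw [map_neg] at this
    linarith
  have hFle {f} (hf : p f ≤ 0) : F f ≤ 0 := by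
    refine le_of_forall_pos_le_add fun δ hδ ↦ ?_
    have hδe : 0 < δ / e := div_pos hδ hepos
    have := hFneg (f := f + (δ / e) • -J Set.univ .univ) <| (hpadd _ _).trans_lt <| by
      rw [hpsmul hδe.le, hpJneg, probReal_univ]
      linarith
    rw [map_add, map_smul, map_neg, smul_eq_mul, mul_neg, ← he, div_mul_cancel₀ _ hepos.ne'] at this
    linarith
  refine ⟨e⁻¹ • F, ?_, fun A hA ↦ ?_, fun f hf ↦ ?_⟩
  · exact inv_mul_cancel₀ hepos.ne'
  · change 1 / (k + 1) * Q.real A ≤ e⁻¹ * F (J A hA) ∧ e⁻¹ * F (J A hA) ≤ (k + 1) * Q.real A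
    rw [← div_eq_inv_mul, le_div_iff₀ hepos, div_le_iff₀ hepos]
    constructor
    · have hy : 0 ≤ 1 / (k + 1) * Q.real A := by positivity
      have := hFle (f := -J A hA + (1 / (k + 1) * Q.real A) • J Set.univ .univ) <|
        (hpadd _ _).trans <| by
          rw [hpsmul hy, hpJ, hpJneg, probReal_univ]
          field_simp
          simp
      rw [map_add, map_smul, map_neg, smul_eq_mul, ← he] at this
      linarith
    · have hy : 0 ≤ (k + 1) * Q.real A := by positivity
      have := hFle (f := J A hA + ((k + 1) * Q.real A) • -J Set.univ .univ) <|
        (hpadd _ _).trans <| by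
          rw [hpsmul hy, hpJ, hpJneg, probReal_univ]
          linarith
      rw [map_add, map_smul, map_neg, smul_eq_mul, ← he] at this
      linarith
  · exact mul_nonpos_of_nonneg_of_nonpos (inv_nonneg.2 hepos.le) (hFK f hf)

end

/-- **Finite-family step in the proof of the FTAP.**
Let `L` be a convex cone of random variables, `Q` a probability and `k ≥ 0` with every
`X ∈ L` `Q`-integrable and `E_Q(X) ≤ k·E_Q(X⁻)`. Set `t = k + 1`. Then for every finite
family `X₁, …, Xₙ ∈ L` there is a probability `P` with `(1/t)·Q ≤ P ≤ t·Q` and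
`E_P(X_j) ≤ 0` for every `j`. -/
theorem stmt_3 {Ω : Type*} [MeasurableSpace Ω] (P₀ : Measure Ω) [IsProbabilityMeasure P₀]
    (L : Set (Ω → ℝ)) (hLmeas : ∀ X ∈ L, Measurable X)
    (hLadd : ∀ X ∈ L, ∀ Y ∈ L, X + Y ∈ L)
    (hLsmul : ∀ X ∈ L, ∀ c : ℝ, 0 ≤ c → c • X ∈ L)
    (Q : Measure Ω) [IsProbabilityMeasure Q] (k : ℝ) (hk : 0 ≤ k)
    (hint : ∀ X ∈ L, Integrable X Q)
    (hineq : ∀ X ∈ L, ∫ ω, X ω ∂Q ≤ k * ∫ ω, max (-(X ω)) 0 ∂Q)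
    (t : ℝ) (ht : t = k + 1) :
    ∀ (n : ℕ) (Xs : Fin n → Ω → ℝ), (∀ j, Xs j ∈ L) →
      ∃ P : Measure Ω, IsProbabilityMeasure P ∧
        (∀ A : Set Ω, MeasurableSet A →
          ENNReal.ofReal (1 / t) * Q A ≤ P A ∧ P A ≤ ENNReal.ofReal t * Q A) ∧
        ∀ j, Integrable (Xs j) P ∧ ∫ ω, Xs j ω ∂P ≤ 0 := by
  intro n Xs hXs
  subst ht
  have ht1 : 0 < k + 1 := by linarith
  rcases L.eq_empty_or_nonempty with rfl | ⟨X₀, hX₀⟩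
  · refine ⟨Q, inferInstance, fun A _ ↦ ⟨?_, ?_⟩, fun j ↦ (hXs j).elim⟩
    · refine mul_le_of_le_one_left' (ENNReal.ofReal_le_one.2 ?_)
      rw [div_le_one ht1]
      linarith
    · exact le_mul_of_one_le_left' (ENNReal.one_le_ofReal.2 (by linarith))
  let K : ConvexCone ℝ (Lp ℝ 1 Q) :=
    { carrier := {f | ∃ X ∈ L, f =ᵐ[Q] X}
      smul_mem' := by
        rintro c hc f ⟨X, hX, hfX⟩
        exact ⟨c • X, hLsmul X hX c hc.le, (Lp.coeFn_smul c f).trans (hfX.const_smul c)⟩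
      add_mem' := by
        rintro f ⟨X, hX, hfX⟩ g ⟨Y, hY, hgY⟩
        exact ⟨X + Y, hLadd X hX Y hY, (Lp.coeFn_add f g).trans (hfX.add hgY)⟩ }
  have hK0 : (0 : Lp ℝ 1 Q) ∈ K :=
    ⟨(0 : ℝ) • X₀, hLsmul X₀ hX₀ 0 le_rfl, by simpa using Lp.coeFn_zero ℝ 1 Q⟩
  have hK (f) (hf : f ∈ K) : (k + 2) * ∫ ω, f ω ∂Q ≤ k * ‖f‖ := by
    obtain ⟨X, hX, hfX⟩ := hf
    have hneg : ∫ ω, max (-(X ω)) 0 ∂Q = (∫ ω, ‖X ω‖ ∂Q - ∫ ω, X ω ∂Q) / 2 := by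
      rw [← integral_sub (hint X hX).norm (hint X hX), ← integral_div]
      refine integral_congr_ae (ae_of_all _ fun ω ↦ ?_)
      simp only [Real.norm_eq_abs]
      rcases le_total 0 (X ω) with h | h
      · rw [max_eq_right (by linarith), abs_of_nonneg h]; ring
      · rw [max_eq_left (by linarith), abs_of_nonpos h]; ring
    have h := hineq X hX
    rw [hneg] at h
    have hnorm : ∫ ω, ‖f ω‖ ∂Q = ∫ ω, ‖X ω‖ ∂Q := integral_congr_ae (hfX.fun_comp norm)
    rw [L1.norm_eq_integral_norm, hnorm, integral_congr_ae hfX]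
    linarith
  obtain ⟨F, hF1, hFQ, hFK⟩ := exists_functional_nonpos hk K hK0 hK
  obtain ⟨P, hPF, hPint⟩ := exists_measure_of_functional F ht1.le
    (fun A hA ↦ le_trans (by positivity) (hFQ A hA).1) (fun A hA ↦ (hFQ A hA).2)
  refine ⟨P, ⟨by rw [hPF _ .univ, hF1, ENNReal.ofReal_one]⟩, fun A hA ↦ ?_, fun j ↦ ?_⟩
  · rw [hPF A hA, ← ofReal_measureReal (μ := Q) (s := A), ← ENNReal.ofReal_mul (by positivity),
      ← ENNReal.ofReal_mul ht1.le]
    exact ⟨ENNReal.ofReal_le_ofReal (hFQ A hA).1, ENNReal.ofReal_le_ofReal (hFQ A hA).2⟩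
  · have hX := hint _ (hXs j)
    obtain ⟨h1, h2⟩ := hPint _ hX
    exact ⟨h1, h2.trans_le (hFK _ ⟨_, hXs j, hX.coeFn_toL1⟩)⟩
end

section
/- Let Q be a σ-additive probability measure on (Ω, 𝒜), t ≥ 1 a constant, and X : Ω → ℝ a Q-integrable random variable. Let (P_i)_{i ∈ I} be a net of σ-additive probability measures on 𝒜 such that (1/t)·Q(A) ≤ P_i(A) ≤ t·Q(A) for all i and all A ∈ 𝒜, and suppose P_i(A) → P(A) for every A ∈ 𝒜, where P is a function from 𝒜 to [0, 1]. Then P is a σ-additive probability measure on 𝒜 with (1/t)·Q(A) ≤ P(A) ≤ t·Q(A) for all A ∈ 𝒜, X is P-integrable, and E_{P_i}(X) → E_P(X) along the net. -/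
open MeasureTheory Filter Topology

/-- If `μ ≤ c • Q`, then integration against `μ` is `c`-Lipschitz for the `L¹(Q)` distance. -/
theorem abs_integral_sub_le_of_le_smul {Ω : Type*} [MeasurableSpace Ω] {Q μ : Measure Ω} {c : ℝ}
    (hc : 0 ≤ c) (hμ : μ ≤ ENNReal.ofReal c • Q) {f g : Ω → ℝ} (hf : Integrable f Q)
    (hg : Integrable g Q) :
    |∫ ω, f ω ∂μ - ∫ ω, g ω ∂μ| ≤ c * ∫ ω, ‖f ω - g ω‖ ∂Q := by
  have hfμ : Integrable f μ := hf.of_measure_le_smul ENNReal.ofReal_ne_top hμ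
  have hgμ : Integrable g μ := hg.of_measure_le_smul ENNReal.ofReal_ne_top hμ
  rw [← integral_sub hfμ hgμ, ← Real.norm_eq_abs]
  calc ‖∫ ω, f ω - g ω ∂μ‖ ≤ ∫ ω, ‖f ω - g ω‖ ∂μ := norm_integral_le_integral_norm _
    _ ≤ ∫ ω, ‖f ω - g ω‖ ∂(ENNReal.ofReal c • Q) :=
        integral_mono_measure hμ (ae_of_all _ fun _ => norm_nonneg _)
          ((hf.sub hg).norm.smul_measure ENNReal.ofReal_ne_top)
    _ = c * ∫ ω, ‖f ω - g ω‖ ∂Q := by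
        rw [integral_smul_measure, ENNReal.toReal_ofReal hc, smul_eq_mul]

/-- Setwise convergence of measures dominated by a common multiple of a measure `Q` implies
convergence of the integrals of every `Q`-integrable function. -/
theorem tendsto_integral_of_tendsto_measureReal_of_le_smul {Ω ι : Type*} [MeasurableSpace Ω]
    {Q μ : Measure Ω} {c : ℝ} (hc : 0 ≤ c) {ν : ι → Measure Ω}
    {l : Filter ι} (hν : ∀ i, ν i ≤ ENNReal.ofReal c • Q) (hμ : μ ≤ ENNReal.ofReal c • Q)
    (hconv : ∀ A, MeasurableSet A → Tendsto (fun i => (ν i).real A) l (𝓝 (μ.real A)))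
    {f : Ω → ℝ} (hf : Integrable f Q) :
    Tendsto (fun i => ∫ ω, f ω ∂(ν i)) l (𝓝 (∫ ω, f ω ∂μ)) := by
  have integrable_of_le {ρ : Measure Ω} (hρ : ρ ≤ ENNReal.ofReal c • Q) {g : Ω → ℝ}
      (hg : Integrable g Q) : Integrable g ρ :=
    hg.of_measure_le_smul ENNReal.ofReal_ne_top hρ
  have ac_of_le {ρ : Measure Ω} (hρ : ρ ≤ ENNReal.ofReal c • Q) : ρ ≪ Q :=
    Measure.absolutelyContinuous_of_le_smul hρ
  refine Integrable.induction (fun f => Tendsto (fun i => ∫ ω, f ω ∂(ν i)) l (𝓝 (∫ ω, f ω ∂μ)))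
    ?indicator ?add ?isClosed ?ae_eq hf
  case indicator =>
    intro a s hs _
    simpa only [integral_indicator_const _ hs, smul_eq_mul] using (hconv _ hs).mul_const a
  case add =>
    intro f g _ hf hg ihf ihg
    simp only [Pi.add_apply]
    rw [integral_add (integrable_of_le hμ hf) (integrable_of_le hμ hg)]
    refine (ihf.add ihg).congr fun i => ?_
    rw [integral_add (integrable_of_le (hν i) hf) (integrable_of_le (hν i) hg)]
  case ae_eq =>
    intro f g hfg _ ih
    rw [← integral_congr_ae ((ac_of_le hμ).ae_le hfg)]
    exact ih.congr fun i => integral_congr_ae ((ac_of_le (hν i)).ae_le hfg)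
  case isClosed =>
    refine isClosed_of_closure_subset fun f hf => Metric.tendsto_nhds.2 fun ε hε => ?_
    obtain ⟨g, hg, hfg⟩ := Metric.mem_closure_iff.1 hf (ε / (3 * (c + 1))) (by positivity)
    have hdist {ρ : Measure Ω} (hρ : ρ ≤ ENNReal.ofReal c • Q) :
        |∫ ω, f ω ∂ρ - ∫ ω, g ω ∂ρ| < ε / 3 := by
      refine (abs_integral_sub_le_of_le_smul hc hρ (L1.integrable_coeFn f)
        (L1.integrable_coeFn g)).trans_lt ?_
      simp only [← dist_eq_norm, ← L1.dist_eq_integral_dist]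
      rw [lt_div_iff₀ (by positivity)] at hfg ⊢
      nlinarith [dist_nonneg (x := f) (y := g)]
    filter_upwards [Metric.tendsto_nhds.1 hg (ε / 3) (by positivity)] with i hi
    have h₁ := abs_lt.1 (hdist (hν i))
    have h₂ := abs_lt.1 (hdist hμ)
    rw [Real.dist_eq, abs_lt] at hi ⊢
    constructor <;> linarith [hi.1, hi.2, h₁.1, h₁.2, h₂.1, h₂.2]

/-- A setwise limit of measures dominated by a common finite measure is a measure. -/
theorem exists_measure_of_tendsto_measureReal {Ω ι : Type*} [MeasurableSpace Ω] {Q : Measure Ω}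
    [IsFiniteMeasure Q] {ν : ι → Measure Ω} {l : Filter ι} [l.NeBot] (hν : ∀ i, ν i ≤ Q)
    {P : Set Ω → ℝ} (hconv : ∀ A, MeasurableSet A → Tendsto (fun i => (ν i).real A) l (𝓝 (P A))) :
    ∃ μ : Measure Ω, ∀ A, MeasurableSet A → μ A = ENNReal.ofReal (P A) := by
  have hP_nonneg {A : Set Ω} (hA : MeasurableSet A) : 0 ≤ P A :=
    ge_of_tendsto' (hconv A hA) fun _ => measureReal_nonneg
  have hfin (i : ι) : IsFiniteMeasure (ν i) := isFiniteMeasure_of_le Q (hν i)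
  have hνQ (i : ι) (A : Set Ω) : (ν i).real A ≤ Q.real A :=
    ENNReal.toReal_mono (measure_ne_top Q A) (hν i A)
  have hempty : P ∅ = 0 :=
    tendsto_nhds_unique (hconv ∅ .empty) (by simp)
  have hUnion (A : ℕ → Set Ω) (hA : ∀ n, MeasurableSet (A n))
      (hd : Pairwise (Function.onFun Disjoint A)) :
      ENNReal.ofReal (P (⋃ n, A n)) = ∑' n, ENNReal.ofReal (P (A n)) := by
    have hsum {ρ : Measure Ω} [IsFiniteMeasure ρ] :
        HasSum (fun n => ρ.real (A n)) (ρ.real (⋃ n, A n)) := by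
      have htop : ∑' n, ρ (A n) ≠ ⊤ := by
        rw [← measure_iUnion hd hA]; exact measure_ne_top _ _
      have := ENNReal.hasSum_toReal htop
      rwa [← ENNReal.tsum_toReal_eq fun n => measure_ne_top ρ (A n), ← measure_iUnion hd hA] at this
    have hle (n : ℕ) : P (A n) ≤ Q.real (A n) :=
      le_of_tendsto' (hconv _ (hA n)) fun i => hνQ i _
    have hsummable : Summable fun n => P (A n) :=
      hsum.summable.of_nonneg_of_le (fun n => hP_nonneg (hA n)) hle
    rw [← ENNReal.ofReal_tsum_of_nonneg (fun n => hP_nonneg (hA n)) hsummable]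
    congr 1
    refine tendsto_nhds_unique (hconv _ (.iUnion hA)) ?_
    have := tendsto_tsum_of_dominated_convergence (𝓕 := l) (f := fun i n => (ν i).real (A n))
      (hsum (ρ := Q)).summable (fun n => hconv _ (hA n))
      (.of_forall fun i n => by
        rw [Real.norm_of_nonneg measureReal_nonneg]; exact hνQ i _)
    exact this.congr fun i => hsum.tsum_eq
  exact ⟨Measure.ofMeasurable (fun A _ => ENNReal.ofReal (P A)) (by simp [hempty]) hUnion,
    fun A hA => Measure.ofMeasurable_apply A hA⟩

/-- **Setwise limits of uniformly comparable probability measures.**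
Let `Q` be a probability measure, `t ≥ 1`, `X` a `Q`-integrable random variable, and
`(P_i)` a net of probability measures with `(1/t)·Q ≤ P_i ≤ t·Q` converging setwise to a
set function `P` with values in `[0,1]`. Then `P` is a σ-additive probability measure
with `(1/t)·Q ≤ P ≤ t·Q`, `X` is `P`-integrable, and `E_{P_i}(X) → E_P(X)`. -/
theorem stmt_4 {Ω : Type*} [MeasurableSpace Ω] (Q : Measure Ω) [IsProbabilityMeasure Q]
    (t : ℝ) (ht : 1 ≤ t) (X : Ω → ℝ) (hXmeas : Measurable X) (hXint : Integrable X Q)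
    {ι : Type*} [Preorder ι] [IsDirected ι (· ≤ ·)] [Nonempty ι]
    (Pn : ι → Measure Ω) (hPn : ∀ i, IsProbabilityMeasure (Pn i))
    (hPnbd : ∀ i, ∀ A : Set Ω, MeasurableSet A →
      ENNReal.ofReal (1 / t) * Q A ≤ Pn i A ∧ Pn i A ≤ ENNReal.ofReal t * Q A)
    (P : Set Ω → ℝ) (hP01 : ∀ A : Set Ω, MeasurableSet A → 0 ≤ P A ∧ P A ≤ 1)
    (hconv : ∀ A : Set Ω, MeasurableSet A →
      Tendsto (fun i => (Pn i A).toReal) atTop (𝓝 (P A))) :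
    ∃ μ : Measure Ω, IsProbabilityMeasure μ ∧
      (∀ A : Set Ω, MeasurableSet A → (μ A).toReal = P A) ∧
      (∀ A : Set Ω, MeasurableSet A →
        ENNReal.ofReal (1 / t) * Q A ≤ μ A ∧ μ A ≤ ENNReal.ofReal t * Q A) ∧
      Integrable X μ ∧
      Tendsto (fun i => ∫ ω, X ω ∂(Pn i)) atTop (𝓝 (∫ ω, X ω ∂μ)) := by
  have ht0 : 0 ≤ t := zero_le_one.trans ht
  have hνQ (i : ι) : Pn i ≤ ENNReal.ofReal t • Q :=
    Measure.le_iff.2 fun A hA => (hPnbd i A hA).2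
  have : IsFiniteMeasure (ENNReal.ofReal t • Q) := Q.smul_finite ENNReal.ofReal_ne_top
  obtain ⟨μ, hμ⟩ := exists_measure_of_tendsto_measureReal hνQ hconv
  have hμreal (A : Set Ω) (hA : MeasurableSet A) : (μ A).toReal = P A := by
    rw [hμ A hA, ENNReal.toReal_ofReal (hP01 A hA).1]
  have htend (A : Set Ω) (hA : MeasurableSet A) :
      Tendsto (fun i => Pn i A) atTop (𝓝 (μ A)) := by
    rw [hμ A hA]
    exact (ENNReal.tendsto_ofReal (hconv A hA)).congr fun i =>
      ENNReal.ofReal_toReal (measure_ne_top _ _)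
  have hμbd (A : Set Ω) (hA : MeasurableSet A) :
      ENNReal.ofReal (1 / t) * Q A ≤ μ A ∧ μ A ≤ ENNReal.ofReal t * Q A :=
    ⟨ge_of_tendsto' (htend A hA) fun i => (hPnbd i A hA).1,
      le_of_tendsto' (htend A hA) fun i => (hPnbd i A hA).2⟩
  have hμQ : μ ≤ ENNReal.ofReal t • Q := Measure.le_iff.2 fun A hA => (hμbd A hA).2
  refine ⟨μ, ⟨?_⟩, hμreal, hμbd, hXint.of_measure_le_smul ENNReal.ofReal_ne_top hμQ,
    tendsto_integral_of_tendsto_measureReal_of_le_smul ht0 hνQ hμQ (fun A hA => ?_) hXint⟩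
  · exact tendsto_nhds_unique (htend _ .univ) (by simp)
  · rw [measureReal_def, hμreal A hA]
    exact hconv A hA
end

section
/- Let L be a linear space of real random variables on (Ω, 𝒜, P₀) (i.e., a·X + b·Y ∈ L whenever X, Y ∈ L and a, b ∈ ℝ) and Q a σ-additive probability measure on 𝒜 such that every X ∈ L is Q-integrable. (i) If there is a constant k ≥ 0 with E_Q(X) ≤ k·E_Q(X⁻) for every X ∈ L, then |E_Q(X)| ≤ (k/(k+2))·E_Q(|X|) for every X ∈ L. (ii) Conversely, if there is a constant c ∈ [0, 1) with |E_Q(X)| ≤ c·E_Q(|X|) for every X ∈ L, then E_Q(X) ≤ (2c/(1−c))·E_Q(X⁻) for every X ∈ L. -/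
open MeasureTheory Filter Topology

/-- The identity `E|X| = E X + 2 E X⁻` for an integrable real function `X`. -/
theorem integral_abs_eq_integral_add_two_mul_integral_negPart {Ω : Type*} [MeasurableSpace Ω]
    {Q : Measure Ω} {X : Ω → ℝ} (hX : Integrable X Q) :
    ∫ ω, |X ω| ∂Q = ∫ ω, X ω ∂Q + 2 * ∫ ω, max (-(X ω)) 0 ∂Q := by
  have hneg : Integrable (fun ω => max (-(X ω)) 0) Q := hX.neg_part
  rw [← integral_const_mul, ← integral_add hX (hneg.const_mul 2)]
  congr 1 with ω
  rcases le_total 0 (X ω) with h | h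
  · rw [abs_of_nonneg h, max_eq_right (by linarith)]
    ring
  · rw [abs_of_nonpos h, max_eq_left (by linarith)]
    ring

/-- **Equivalence of conditions (b*) and (b**) for a linear space `L`.**
(i) If `E_Q(X) ≤ k·E_Q(X⁻)` for all `X ∈ L` (with `k ≥ 0`), then
`|E_Q(X)| ≤ (k/(k+2))·E_Q(|X|)` for all `X ∈ L`.
(ii) If `|E_Q(X)| ≤ c·E_Q(|X|)` for all `X ∈ L` (with `0 ≤ c < 1`), then
`E_Q(X) ≤ (2c/(1−c))·E_Q(X⁻)` for all `X ∈ L`. -/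
theorem stmt_5 {Ω : Type*} [MeasurableSpace Ω] (P₀ : Measure Ω) [IsProbabilityMeasure P₀]
    (L : Set (Ω → ℝ)) (hLmeas : ∀ X ∈ L, Measurable X)
    (hLlin : ∀ X ∈ L, ∀ Y ∈ L, ∀ a b : ℝ, a • X + b • Y ∈ L)
    (Q : Measure Ω) [IsProbabilityMeasure Q] (hint : ∀ X ∈ L, Integrable X Q) :
    (∀ k : ℝ, 0 ≤ k →
      (∀ X ∈ L, ∫ ω, X ω ∂Q ≤ k * ∫ ω, max (-(X ω)) 0 ∂Q) →
      ∀ X ∈ L, |∫ ω, X ω ∂Q| ≤ (k / (k + 2)) * ∫ ω, |X ω| ∂Q) ∧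
    (∀ c : ℝ, 0 ≤ c → c < 1 →
      (∀ X ∈ L, |∫ ω, X ω ∂Q| ≤ c * ∫ ω, |X ω| ∂Q) →
      ∀ X ∈ L, ∫ ω, X ω ∂Q ≤ (2 * c / (1 - c)) * ∫ ω, max (-(X ω)) 0 ∂Q) := by
  refine ⟨fun k hk hb X hX => ?_, fun c _ hc1 hb X hX => ?_⟩
  · have key : ∀ Y ∈ L, ∫ ω, Y ω ∂Q ≤ (k / (k + 2)) * ∫ ω, |Y ω| ∂Q := by
      intro Y hY
      have hYb := hb Y hY
      have hYabs := integral_abs_eq_integral_add_two_mul_integral_negPart (hint Y hY)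
      rw [div_mul_eq_mul_div, le_div_iff₀ (by linarith), hYabs]
      linarith
    have hnegX : -X ∈ L := by simpa using hLlin X hX X hX (-1) 0
    have hle := key (-X) hnegX
    simp only [Pi.neg_apply, abs_neg, integral_neg] at hle
    exact abs_le'.2 ⟨key X hX, hle⟩
  · have hE := (le_abs_self _).trans (hb X hX)
    rw [integral_abs_eq_integral_add_two_mul_integral_negPart (hint X hX)] at hE
    rw [div_mul_eq_mul_div, le_div_iff₀ (by linarith)]
    linarith
end

section
/- Let L be a convex cone of real bounded random variables on (Ω, 𝒜, P₀). Suppose there exist a σ-additive probability measure Q on 𝒜 with Q ~ P₀ and a constant k ≥ 0 such that E_Q(X) ≤ k·ess sup(−X) for every X ∈ L. Then there exist events Aₙ ∈ 𝒜 and constants kₙ ≥ 0, n ≥ 1, such that limₙ P₀(Aₙ) = 1 and E_{P₀}[X·1_{Aₙ}] ≤ kₙ·ess sup(−X) for all n ≥ 1 and all X ∈ L. -/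
open MeasureTheory Filter Topology

/-- The essential supremum `ess sup(X) = inf {x ∈ ℝ : P₀(X > x) = 0}` of a real random
variable `X` with respect to `P₀` (finite when `X` is bounded). -/
noncomputable def essSupR {Ω : Type*} [MeasurableSpace Ω] (P₀ : MeasureTheory.Measure Ω)
    (X : Ω → ℝ) : ℝ :=
  sInf {x : ℝ | P₀ {ω | x < X ω} = 0}

/-- A function is almost everywhere at most its essential supremum. -/
theorem ae_le_essSupR {Ω : Type*} [MeasurableSpace Ω] {P : Measure Ω} [NeZero P]
    {X : Ω → ℝ} {M : ℝ} (hM : ∀ ω, |X ω| ≤ M) : ∀ᵐ ω ∂P, X ω ≤ essSupR P X := by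
  have hne : {x : ℝ | P {ω | x < X ω} = 0}.Nonempty := by
    refine ⟨M, ?_⟩
    have : {ω | M < X ω} = ∅ := by
      ext ω
      simpa using (le_abs_self _).trans (hM ω)
    simp [this]
  have hlt : ∀ n : ℕ, ∀ᵐ ω ∂P, X ω ≤ essSupR P X + 1 / ((n : ℝ) + 1) := by
    intro n
    obtain ⟨t, ht, hts⟩ := exists_lt_of_csInf_lt hne
      (lt_add_of_pos_right (essSupR P X) (Nat.one_div_pos_of_nat (α := ℝ) (n := n)))
    have ht' : ∀ᵐ ω ∂P, X ω ≤ t := by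
      rw [ae_iff]
      simpa only [not_le, Set.mem_ofPred_eq] using ht
    filter_upwards [ht'] with ω hω
    exact hω.trans hts.le
  filter_upwards [ae_all_iff.2 hlt] with ω hω
  refine le_of_forall_pos_le_add fun ε hε => ?_
  obtain ⟨n, hn⟩ := exists_nat_one_div_lt hε
  exact (hω n).trans (by gcongr)

/-- A measure restricted to a sublevel set of its density is dominated by a multiple of the
reference measure. -/
theorem restrict_rnDeriv_le_le_smul {Ω : Type*} [MeasurableSpace Ω] {P Q : Measure Ω}
    [SigmaFinite P] [SigmaFinite Q] (hPQ : P ≪ Q) (c : ENNReal) :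
    P.restrict {ω | P.rnDeriv Q ω ≤ c} ≤ c • Q := by
  have hA : MeasurableSet {ω | P.rnDeriv Q ω ≤ c} :=
    measurableSet_le (Measure.measurable_rnDeriv P Q) measurable_const
  refine Measure.le_iff.2 fun B hB => ?_
  rw [Measure.restrict_apply hB, ← Measure.setLIntegral_rnDeriv hPQ, Measure.smul_apply,
    smul_eq_mul]
  calc ∫⁻ ω in B ∩ {ω | P.rnDeriv Q ω ≤ c}, P.rnDeriv Q ω ∂Q
      ≤ ∫⁻ _ in B ∩ {ω | P.rnDeriv Q ω ≤ c}, c ∂Q :=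
        setLIntegral_mono measurable_const fun ω hω => hω.2
    _ = c * Q (B ∩ {ω | P.rnDeriv Q ω ≤ c}) := setLIntegral_const _ _
    _ ≤ c * Q B := by gcongr; exact Set.inter_subset_left

/-- The sublevel sets of the density of a probability measure exhaust its mass. -/
theorem tendsto_measure_rnDeriv_le_natCast {Ω : Type*} [MeasurableSpace Ω] {P Q : Measure Ω}
    [IsProbabilityMeasure P] (hPQ : P ≪ Q) :
    Tendsto (fun n : ℕ => (P {ω | P.rnDeriv Q ω ≤ n}).toReal) atTop (𝓝 1) := by
  have hmono : Monotone fun n : ℕ => {ω | P.rnDeriv Q ω ≤ n} := fun m n hmn ω hω =>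
    le_trans (b := (m : ENNReal)) hω (by exact_mod_cast hmn)
  have hU : P (⋃ n : ℕ, {ω | P.rnDeriv Q ω ≤ n}) = 1 := by
    rw [← measure_univ (μ := P)]
    refine measure_congr ?_
    filter_upwards [hPQ.ae_le (Measure.rnDeriv_lt_top P Q)] with ω hω
    obtain ⟨n, hn⟩ := ENNReal.exists_nat_gt hω.ne
    exact propext ⟨fun _ => trivial, fun _ => Set.mem_iUnion.2 ⟨n, hn.le⟩⟩
  have h := tendsto_measure_iUnion_atTop (μ := P) hmono
  rw [hU] at h
  exact (ENNReal.tendsto_toReal ENNReal.one_ne_top).comp h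

/-- **(b) implies (c) in the portmanteau theorem for ESFA's.**
If `L` is a convex cone of bounded random variables and `E_Q(X) ≤ k·ess sup(−X)` for
every `X ∈ L`, where `Q ~ P₀` is σ-additive and `k ≥ 0`, then there are events `Aₙ` and
constants `kₙ ≥ 0` with `P₀(Aₙ) → 1` and `E_{P₀}[X·1_{Aₙ}] ≤ kₙ·ess sup(−X)` for all
`n` and all `X ∈ L`. -/
theorem stmt_6 {Ω : Type*} [MeasurableSpace Ω] (P₀ : Measure Ω) [IsProbabilityMeasure P₀]
    (L : Set (Ω → ℝ)) (hLmeas : ∀ X ∈ L, Measurable X)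
    (hLbdd : ∀ X ∈ L, ∃ M : ℝ, ∀ ω, |X ω| ≤ M)
    (hLadd : ∀ X ∈ L, ∀ Y ∈ L, X + Y ∈ L)
    (hLsmul : ∀ X ∈ L, ∀ c : ℝ, 0 ≤ c → c • X ∈ L)
    (Q : Measure Ω) [IsProbabilityMeasure Q] (hQ₁ : Q ≪ P₀) (hQ₂ : P₀ ≪ Q)
    (k : ℝ) (hk : 0 ≤ k)
    (hb : ∀ X ∈ L, ∫ ω, X ω ∂Q ≤ k * essSupR P₀ (fun ω => -X ω)) :
    ∃ (A : ℕ → Set Ω) (ks : ℕ → ℝ),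
      (∀ n, MeasurableSet (A n)) ∧ (∀ n, 0 ≤ ks n) ∧
      Tendsto (fun n => (P₀ (A n)).toReal) atTop (𝓝 1) ∧
      ∀ n, ∀ X ∈ L, ∫ ω in A n, X ω ∂P₀ ≤ ks n * essSupR P₀ (fun ω => -X ω) := by
  refine ⟨fun n => {ω | P₀.rnDeriv Q ω ≤ n}, fun n => n * (k + 1),
    fun n => measurableSet_le (Measure.measurable_rnDeriv P₀ Q) measurable_const,
    fun n => by positivity, tendsto_measure_rnDeriv_le_natCast hQ₂, fun n X hX => ?_⟩
  obtain ⟨M, hM⟩ := hLbdd X hX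
  have hint : ∀ (μ : Measure Ω) [IsFiniteMeasure μ], Integrable X μ := fun μ _ =>
    Integrable.of_bound (hLmeas X hX).aestronglyMeasurable M (Eventually.of_forall hM)
  have hle : ∀ᵐ ω ∂P₀, -X ω ≤ essSupR P₀ (fun ω => -X ω) :=
    ae_le_essSupR (M := M) fun ω => by simpa using hM ω
  have hXQ := hb X hX
  set s := essSupR P₀ (fun ω => -X ω)
  have hnonneg : ∀ᵐ ω ∂Q, 0 ≤ X ω + s := by
    filter_upwards [hQ₁.ae_le hle] with ω hω
    linarith
  have hQadd : ∫ ω, (X ω + s) ∂Q = ∫ ω, X ω ∂Q + s := by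
    rw [integral_add (hint Q) (integrable_const s)]
    simp
  have hs : 0 ≤ s := by
    by_contra! hneg
    have h0 := integral_nonneg_of_ae hnonneg
    have hks := mul_nonpos_of_nonneg_of_nonpos hk hneg.le
    linarith
  have hnQ : Integrable (fun ω => X ω + s) ((n : ENNReal) • Q) :=
    ((hint Q).add (integrable_const s)).smul_measure (ENNReal.natCast_ne_top n)
  calc ∫ ω in {ω | P₀.rnDeriv Q ω ≤ n}, X ω ∂P₀
      ≤ ∫ ω in {ω | P₀.rnDeriv Q ω ≤ n}, (X ω + s) ∂P₀ :=
        integral_mono (hint _) ((hint _).add (integrable_const s)) fun ω =>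
          le_add_of_nonneg_right hs
    _ ≤ ∫ ω, (X ω + s) ∂((n : ENNReal) • Q) :=
        integral_mono_measure (restrict_rnDeriv_le_le_smul hQ₂ n)
          (Measure.ae_smul_measure hnonneg _) hnQ
    _ = n * (∫ ω, X ω ∂Q + s) := by
        rw [integral_smul_measure, hQadd]
        simp
    _ ≤ n * (k * s + s) := by gcongr
    _ = n * (k + 1) * s := by ring
end

section
/- Let L be a convex cone of real bounded random variables on (Ω, 𝒜, P₀). Suppose there exist events Aₙ ∈ 𝒜 and constants kₙ ≥ 0, n ≥ 1, such that limₙ P₀(Aₙ) = 1 and E_{P₀}[X·1_{Aₙ}] ≤ kₙ·ess sup(−X) for all n ≥ 1 and all X ∈ L. Then the family of laws {P₀ ∘ X⁻¹ : X ∈ L, X ≥ −1 P₀-a.s.} is tight; that is, for every ε > 0 there is M > 0 such that P₀(|X| > M) < ε for every X ∈ L with X ≥ −1 P₀-a.s. -/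
open MeasureTheory Filter Topology

/-- A lower bound for a bounded random variable controls the essential supremum of its negative. -/
lemma essSupR_neg_le {Ω : Type*} [MeasurableSpace Ω] (P : Measure Ω) [NeZero P] {X : Ω → ℝ}
    {M c : ℝ} (hM : ∀ ω, X ω ≤ M) (hc : ∀ᵐ ω ∂P, -c ≤ X ω) :
    essSupR P (fun ω => -X ω) ≤ c := by
  refine csInf_le ⟨-M, fun x hx => ?_⟩ ?_
  · by_contra! h
    have huniv : {ω | x < -X ω} = Set.univ :=
      Set.eq_univ_of_forall fun ω => h.trans_le (neg_le_neg (hM ω))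
    rw [Set.mem_ofPred_eq, huniv, Measure.measure_univ_eq_zero] at hx
    exact NeZero.ne P hx
  · rw [ae_iff] at hc
    simpa only [Set.mem_ofPred_eq, not_le, lt_neg] using hc

/-- A Markov bound on the event `A` for random variables bounded below by `-1`. -/
lemma mul_measureReal_abs_gt_inter_le {Ω : Type*} [MeasurableSpace Ω] (P : Measure Ω)
    [IsProbabilityMeasure P] {X : Ω → ℝ} (hX : Integrable X P) (hlb : ∀ᵐ ω ∂P, -1 ≤ X ω)
    {A : Set Ω} (hA : MeasurableSet A) {M : ℝ} (hM : 1 ≤ M) :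
    M * P.real ({ω | M < |X ω|} ∩ A) ≤ ∫ ω in A, X ω ∂P + 1 := by
  have hmarkov : M * (P.restrict A).real {ω | M ≤ X ω + 1} ≤ ∫ ω in A, (X ω + 1) ∂P := by
    refine mul_meas_ge_le_integral_of_nonneg ?_ (hX.restrict.add (integrable_const 1)) M
    filter_upwards [ae_restrict_of_ae hlb] with ω h
    simpa using neg_le_iff_add_nonneg.mp h
  have hsub : P.real ({ω | M < |X ω|} ∩ A) ≤ (P.restrict A).real {ω | M ≤ X ω + 1} := by
    rw [measureReal_restrict_apply' hA]
    refine ENNReal.toReal_mono (measure_ne_top _ _) (measure_mono_ae ?_)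
    filter_upwards [hlb] with ω h
    rintro ⟨h1, h2⟩
    refine ⟨?_, h2⟩
    rcases lt_abs.mp (show M < |X ω| from h1) with h3 | h3
    · exact (h3.trans (lt_add_one _)).le
    · linarith
  have hint : ∫ ω in A, (X ω + 1) ∂P = ∫ ω in A, X ω ∂P + P.real A := by
    rw [integral_add hX.restrict (integrable_const 1)]
    simp
  have hA1 : P.real A ≤ 1 := measureReal_le_one
  have := mul_le_mul_of_nonneg_left hsub (zero_le_one.trans hM)
  linarith

/-- **(c) implies (d) in the portmanteau theorem for ESFA's.**
If `L` is a convex cone of bounded random variables and there are events `Aₙ` and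
constants `kₙ ≥ 0` with `P₀(Aₙ) → 1` and `E_{P₀}[X·1_{Aₙ}] ≤ kₙ·ess sup(−X)` for all
`n ≥ 1` and `X ∈ L`, then `{P₀(X ∈ ·) : X ∈ L, X ≥ −1 a.s.}` is tight. -/
theorem stmt_7 {Ω : Type*} [MeasurableSpace Ω] (P₀ : Measure Ω) [IsProbabilityMeasure P₀]
    (L : Set (Ω → ℝ)) (hLmeas : ∀ X ∈ L, Measurable X)
    (hLbdd : ∀ X ∈ L, ∃ M : ℝ, ∀ ω, |X ω| ≤ M)
    (hLadd : ∀ X ∈ L, ∀ Y ∈ L, X + Y ∈ L)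
    (hLsmul : ∀ X ∈ L, ∀ c : ℝ, 0 ≤ c → c • X ∈ L)
    (A : ℕ → Set Ω) (ks : ℕ → ℝ)
    (hAmeas : ∀ n, MeasurableSet (A n)) (hks : ∀ n, 0 ≤ ks n)
    (hA1 : Tendsto (fun n => (P₀ (A n)).toReal) atTop (𝓝 1))
    (hc : ∀ n, ∀ X ∈ L, ∫ ω in A n, X ω ∂P₀ ≤ ks n * essSupR P₀ (fun ω => -X ω)) :
    ∀ ε : ℝ, 0 < ε → ∃ M : ℝ, 0 < M ∧
      ∀ X ∈ L, (∀ᵐ ω ∂P₀, -1 ≤ X ω) → (P₀ {ω | M < |X ω|}).toReal < ε := by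
  intro ε hε
  obtain ⟨n, hn⟩ := (hA1.eventually (lt_mem_nhds (sub_lt_self 1 (half_pos hε)))).exists
  have hk := hks n
  have hM : 1 ≤ 1 + 2 * (ks n + 1) / ε := by
    have : 0 ≤ 2 * (ks n + 1) / ε := by positivity
    linarith
  refine ⟨1 + 2 * (ks n + 1) / ε, by linarith, fun X hX hlb => ?_⟩
  obtain ⟨B, hB⟩ := hLbdd X hX
  have hint : Integrable X P₀ :=
    .of_bound (hLmeas X hX).aestronglyMeasurable B (ae_of_all _ hB)
  have hmarkov := mul_measureReal_abs_gt_inter_le P₀ hint hlb (hAmeas n) hM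
  have hsup := essSupR_neg_le P₀ (fun ω => (abs_le.mp (hB ω)).2) hlb
  have hcost := (hc n X hX).trans (mul_le_mul_of_nonneg_left hsup hk)
  set S := {ω | 1 + 2 * (ks n + 1) / ε < |X ω|}
  change P₀.real S < ε
  have hsplit : P₀.real S ≤ P₀.real (S ∩ A n) + P₀.real (A n)ᶜ := by
    rw [← measureReal_inter_add_sdiff (s := S) (hAmeas n)]
    exact add_le_add_right (measureReal_mono (Set.sdiff_subset_compl S (A n))) _
  have hcompl : P₀.real (A n)ᶜ = 1 - P₀.real (A n) := probReal_compl_eq_one_sub (hAmeas n)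
  change 1 - ε / 2 < P₀.real (A n) at hn
  have hhalf : P₀.real (S ∩ A n) ≤ ε / 2 := by
    have hp : 0 ≤ P₀.real (S ∩ A n) := measureReal_nonneg
    have hle : 2 * (ks n + 1) / ε * P₀.real (S ∩ A n) ≤ ks n + 1 := by linarith
    rw [div_mul_eq_mul_div, div_le_iff₀ hε] at hle
    nlinarith
  linarith
end

section
/- Let L be a convex cone of real bounded random variables on (Ω, 𝒜, P₀). Suppose the family of laws {P₀ ∘ X⁻¹ : X ∈ L, X ≥ −1 P₀-a.s.} is tight; that is, for every ε > 0 there is M > 0 such that P₀(|X| > M) < ε for every X ∈ L with X ≥ −1 P₀-a.s. Then there exist a σ-additive probability measure Q on 𝒜 with Q ~ P₀ and a constant k ≥ 0 such that E_Q(X) ≤ k·ess sup(−X) for every X ∈ L. -/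
open MeasureTheory Filter Topology

open scoped ENNReal

section BoundedInProbability

variable {Ω : Type*} [MeasurableSpace Ω] {P : Measure Ω} [IsProbabilityMeasure P]

/-- No point `c • 1_A` with `c` large lies in the `L²`-closure of the functions dominated by a
member of a set bounded in probability. -/
lemma indicator_notMem_closure_dominated {C : Set (Ω → ℝ)} {A : Set Ω} (hA : MeasurableSet A)
    {M : ℝ} (hM : 0 < M)
    (hC : ∀ Y ∈ C, (P {ω | M < Y ω}).toReal < (P A).toReal / 2) :
    indicatorConstLp 2 hA (measure_ne_top P A) (2 * M) ∉
      closure {d : Lp ℝ 2 P | ∃ Y ∈ C, d ≤ᵐ[P] Y} := by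
  intro hx
  obtain ⟨d, hd, hlim⟩ := mem_closure_iff_seq_limit.1 hx
  have hmeas := (tendstoInMeasure_of_tendsto_Lp hlim) (ENNReal.ofReal M) (by simpa using hM)
  have hle : ∀ n, ENNReal.ofReal ((P A).toReal / 2) ≤
      P {ω | ENNReal.ofReal M ≤ edist (d n ω)
        (indicatorConstLp 2 hA (measure_ne_top P A) (2 * M) ω)} := by
    intro n
    obtain ⟨Y, hY, hdY⟩ := hd n
    set B := {ω | ENNReal.ofReal M ≤ edist (d n ω)
        (indicatorConstLp 2 hA (measure_ne_top P A) (2 * M) ω)} with hB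
    have hsub : P A ≤ P ({ω | M < Y ω} ∪ B) := by
      apply measure_mono_ae
      filter_upwards [hdY, indicatorConstLp_coeFn (p := 2) (hs := hA)
        (hμs := measure_ne_top P A) (c := 2 * M)] with ω h1 h2 hω
      by_contra hcon
      have hcon' : ω ∉ {ω | M < Y ω} ∪ B := hcon
      simp only [Set.mem_union, not_or, Set.mem_ofPred_eq, not_lt, hB, not_le] at hcon'
      obtain ⟨h3, h4⟩ := hcon'
      have hω' : ω ∈ A := hω
      rw [h2, Set.indicator_of_mem hω', edist_dist, ENNReal.ofReal_lt_ofReal_iff hM,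
        Real.dist_eq, abs_lt] at h4
      linarith [h4.1]
    have h5 := hsub.trans (measure_union_le _ _)
    have h6 : (P A).toReal ≤ (P {ω | M < Y ω}).toReal + (P B).toReal := by
      rw [← ENNReal.toReal_add (measure_ne_top _ _) (measure_ne_top _ _)]
      exact ENNReal.toReal_mono (by finiteness) h5
    rw [ENNReal.ofReal_le_iff_le_toReal (measure_ne_top _ _)]
    linarith [hC Y hY]
  have h0 := ge_of_tendsto' hmeas hle
  obtain ⟨Y, hY, -⟩ := hd 0
  have : 0 < (P A).toReal / 2 := lt_of_le_of_lt ENNReal.toReal_nonneg (hC Y hY)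
  simp only [nonpos_iff_eq_zero, ENNReal.ofReal_eq_zero] at h0
  linarith

/-- A convex set of nonnegative square-integrable functions which is bounded in probability has
bounded expectations with respect to a density that does not vanish on a given non-null set. -/
lemma exists_density_ne_zero_on {C : Set (Ω → ℝ)} (hconv : Convex ℝ C)
    (hL2 : ∀ Y ∈ C, MemLp Y 2 P) (hnonneg : ∀ Y ∈ C, 0 ≤ᵐ[P] Y) (hone : 1 ∈ C)
    (htight : ∀ ε : ℝ, 0 < ε → ∃ M : ℝ, 0 < M ∧ ∀ Y ∈ C, (P {ω | M < Y ω}).toReal < ε)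
    {A : Set Ω} (hA : MeasurableSet A) (hPA : P A ≠ 0) :
    ∃ g : Ω → ℝ≥0∞, Measurable g ∧ (∀ Y ∈ C, ∫⁻ ω, g ω * ENNReal.ofReal (Y ω) ∂P ≤ 1) ∧
      P (A ∩ {ω | g ω ≠ 0}) ≠ 0 := by
  have hPA' : 0 < (P A).toReal := ENNReal.toReal_pos hPA (measure_ne_top _ _)
  obtain ⟨M, hM, hMC⟩ := htight ((P A).toReal / 2) (half_pos hPA')
  have hnot := indicator_notMem_closure_dominated hA hM hMC
  set D : Set (Lp ℝ 2 P) := {d | ∃ Y ∈ C, d ≤ᵐ[P] Y} with hD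
  have hDconv : Convex ℝ D := by
    rintro d ⟨Y, hY, hdY⟩ e ⟨Z, hZ, heZ⟩ a b ha hb hab
    refine ⟨a • Y + b • Z, hconv hY hZ ha hb hab, ?_⟩
    filter_upwards [hdY, heZ, Lp.coeFn_add (a • d) (b • e), Lp.coeFn_smul a d,
      Lp.coeFn_smul b e] with ω h1 h2 h3 h4 h5
    simp only [h3, Pi.add_apply, h4, h5, Pi.smul_apply, smul_eq_mul]
    gcongr
  obtain ⟨f, u, hfu, hux⟩ := geometric_hahn_banach_closed_point hDconv.closure
    isClosed_closure hnot
  replace hfu : ∀ d ∈ D, f d < u := fun d hd => hfu d (subset_closure hd)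
  set g : Lp ℝ 2 P := (InnerProductSpace.toDual ℝ (Lp ℝ 2 P)).symm f with hg
  have hfg : ∀ d : Lp ℝ 2 P, f d = ∫ ω, g ω * d ω ∂P := by
    intro d
    have h1 : inner ℝ g d = f d := InnerProductSpace.toDual_symm_apply
    rw [← h1, L2.inner_def]
    exact integral_congr_ae (ae_of_all _ fun ω => by simp [mul_comm])
  have hf_ind : ∀ (s : Set Ω) (hs : MeasurableSet s) (c : ℝ),
      f (indicatorConstLp 2 hs (measure_ne_top P s) c) = (∫ ω in s, g ω ∂P) * c := by
    intro s hs c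
    rw [hfg, ← integral_mul_const, ← integral_indicator hs]
    apply integral_congr_ae
    filter_upwards [indicatorConstLp_coeFn (p := 2) (hs := hs)
        (hμs := measure_ne_top P s) (c := c)] with ω hω
    rw [hω]
    by_cases h : ω ∈ s <;> simp [h]
  have hfC : ∀ Y ∈ C, ∫ ω, g ω * Y ω ∂P < u := by
    intro Y hY
    have h1 := hfu ((hL2 Y hY).toLp Y) ⟨Y, hY, (MemLp.coeFn_toLp _).le⟩
    rw [hfg] at h1
    convert h1 using 1
    apply integral_congr_ae
    filter_upwards [MemLp.coeFn_toLp (hL2 Y hY)] with ω hω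
    rw [hω]
  have hgint : Integrable g P := (Lp.memLp g).integrable (by norm_num)
  have hg0 : 0 ≤ᵐ[P] g := by
    refine ae_nonneg_of_forall_setIntegral_nonneg hgint fun s hs _ => ?_
    by_contra! hneg
    have h2 : f (indicatorConstLp 2 hs (measure_ne_top P s) (-|u / (∫ ω in s, g ω ∂P)|))
        < u := by
      refine hfu _ ⟨1, hone, ?_⟩
      filter_upwards [indicatorConstLp_coeFn (p := 2) (hs := hs)
        (hμs := measure_ne_top P s) (c := -|u / (∫ ω in s, g ω ∂P)|)] with ω hω
      rw [hω]
      by_cases h : ω ∈ s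
      · simp only [h, Set.indicator_of_mem, Pi.one_apply]
        have := abs_nonneg (u / (∫ ω in s, g ω ∂P))
        linarith
      · simp [h]
    rw [hf_ind] at h2
    rw [abs_div, abs_of_neg hneg, div_neg, neg_neg, mul_div_cancel₀ _ hneg.ne] at h2
    exact h2.not_ge (le_abs_self u)
  have hu : 0 < u := by
    refine lt_of_le_of_lt (integral_nonneg_of_ae ?_) (hfC 1 hone)
    filter_upwards [hg0] with ω hω
    simpa using hω
  have hgA : 0 < ∫ ω in A, g ω ∂P := by
    rw [hf_ind] at hux
    by_contra! hcon
    nlinarith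
  refine ⟨fun ω => ENNReal.ofReal (g ω / u),
    ((Lp.stronglyMeasurable g).measurable.div_const u).ennreal_ofReal, fun Y hY => ?_, fun h0 => ?_⟩
  · have hint : Integrable (fun ω => g ω * Y ω) P := (Lp.memLp g).integrable_mul (hL2 Y hY)
    have h1 : ∫⁻ ω, ENNReal.ofReal (g ω / u) * ENNReal.ofReal (Y ω) ∂P =
        ∫⁻ ω, ENNReal.ofReal (g ω * Y ω / u) ∂P := by
      apply lintegral_congr_ae
      filter_upwards [hg0] with ω hω
      rw [← ENNReal.ofReal_mul (div_nonneg hω hu.le), div_mul_eq_mul_div]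
    rw [h1, ← ofReal_integral_eq_lintegral_ofReal (hint.div_const u), integral_div,
      ENNReal.ofReal_le_one, div_le_one hu]
    · exact (hfC Y hY).le
    · filter_upwards [hg0, hnonneg Y hY] with ω h2 h3
      exact div_nonneg (mul_nonneg h2 h3) hu.le
  · refine hgA.ne' (setIntegral_eq_zero_of_ae_eq_zero ?_)
    have h1 : ∀ᵐ ω ∂P, ω ∉ A ∩ {ω | ENNReal.ofReal (g ω / u) ≠ 0} :=
      measure_eq_zero_iff_ae_notMem.1 h0
    filter_upwards [h1, hg0] with ω h2 h3 hω
    by_contra hne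
    refine h2 ⟨hω, ?_⟩
    simp only [Set.mem_ofPred_eq, ne_eq, ENNReal.ofReal_eq_zero, not_le]
    exact div_pos (lt_of_le_of_ne h3 (Ne.symm hne)) hu

/-- A convex set of nonnegative square-integrable functions which is bounded in probability has
bounded expectations with respect to an almost everywhere positive density. -/
lemma exists_density_ae_ne_zero {C : Set (Ω → ℝ)} (hconv : Convex ℝ C)
    (hmeas : ∀ Y ∈ C, Measurable Y)
    (hL2 : ∀ Y ∈ C, MemLp Y 2 P) (hnonneg : ∀ Y ∈ C, 0 ≤ᵐ[P] Y) (hone : 1 ∈ C)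
    (htight : ∀ ε : ℝ, 0 < ε → ∃ M : ℝ, 0 < M ∧ ∀ Y ∈ C, (P {ω | M < Y ω}).toReal < ε) :
    ∃ g : Ω → ℝ≥0∞, Measurable g ∧ (∀ Y ∈ C, ∫⁻ ω, g ω * ENNReal.ofReal (Y ω) ∂P ≤ 1) ∧
      ∀ᵐ ω ∂P, g ω ≠ 0 := by
  set G : Set (Ω → ℝ≥0∞) :=
    {g | Measurable g ∧ ∀ Y ∈ C, ∫⁻ ω, g ω * ENNReal.ofReal (Y ω) ∂P ≤ 1} with hG
  have hmix : ∀ g : ℕ → Ω → ℝ≥0∞, (∀ n, g n ∈ G) →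
      (fun ω => ∑' n, (2⁻¹ : ℝ≥0∞) ^ (n + 1) * g n ω) ∈ G := by
    intro g hg
    refine ⟨Measurable.tsum fun n => (hg n).1.const_mul _, fun Y hY => ?_⟩
    have hm : ∀ n, Measurable fun ω => g n ω * ENNReal.ofReal (Y ω) :=
      fun n => (hg n).1.mul (hmeas Y hY).ennreal_ofReal
    simp_rw [← ENNReal.tsum_mul_right, mul_assoc]
    rw [lintegral_tsum fun n => ((hm n).const_mul _).aemeasurable]
    calc ∑' n, ∫⁻ ω, (2⁻¹ : ℝ≥0∞) ^ (n + 1) * (g n ω * ENNReal.ofReal (Y ω)) ∂P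
        ≤ ∑' n : ℕ, (2⁻¹ : ℝ≥0∞) ^ (n + 1) := by
          refine ENNReal.tsum_le_tsum fun n => ?_
          rw [lintegral_const_mul _ (hm n)]
          exact mul_le_of_le_one_right' ((hg n).2 Y hY)
      _ = 1 := by
          rw [ENNReal.tsum_geometric_add_one, ENNReal.one_sub_inv_two, inv_inv,
            ENNReal.inv_mul_cancel two_ne_zero ENNReal.ofNat_ne_top]
  have hsupp : ∀ (g : ℕ → Ω → ℝ≥0∞) (n : ℕ), {ω | g n ω ≠ 0} ⊆
      {ω | ∑' n, (2⁻¹ : ℝ≥0∞) ^ (n + 1) * g n ω ≠ 0} := by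
    intro g n ω hω
    simp only [Set.mem_ofPred_eq, ne_eq, ENNReal.tsum_eq_zero, not_forall] at hω ⊢
    exact ⟨n, mul_ne_zero (by simp) hω⟩
  obtain ⟨v, -, hvlim, hvmem⟩ := exists_seq_tendsto_sSup
    (S := (fun g : Ω → ℝ≥0∞ => P {ω | g ω ≠ 0}) '' G)
    ⟨_, 0, ⟨measurable_zero, by simp⟩, rfl⟩ (OrderTop.bddAbove _)
  choose g hg hgv using hvmem
  set h : Ω → ℝ≥0∞ := fun ω => ∑' n, (2⁻¹ : ℝ≥0∞) ^ (n + 1) * g n ω with hh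
  have hhG : h ∈ G := hmix g hg
  have hmax : ∀ g' ∈ G, P {ω | g' ω ≠ 0} ≤ P {ω | h ω ≠ 0} := by
    intro g' hg'
    refine (le_sSup (Set.mem_image_of_mem _ hg')).trans (le_of_tendsto' hvlim fun n => ?_)
    rw [← hgv n]
    exact measure_mono (hsupp g n)
  refine ⟨h, hhG.1, hhG.2, ?_⟩
  have hZmeas : MeasurableSet {ω | h ω = 0} := hhG.1 (measurableSet_singleton 0)
  by_contra hcon
  have hZ : P {ω | h ω = 0} ≠ 0 := by
    simpa [ae_iff] using hcon
  obtain ⟨g', hg'm, hg'C, hg'A⟩ :=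
    exists_density_ne_zero_on hconv hL2 hnonneg hone htight hZmeas hZ
  let w : ℕ → Ω → ℝ≥0∞ := fun n => if n = 0 then h else g'
  have hw : ∀ n, w n ∈ G := by
    intro n
    by_cases hn : n = 0
    · simpa [w, hn] using hhG
    · rw [show w n = g' from if_neg hn]
      exact ⟨hg'm, hg'C⟩
  have hle := hmax _ (hmix w hw)
  have hdisj : Disjoint {ω | h ω ≠ 0} ({ω | h ω = 0} ∩ {ω | g' ω ≠ 0}) :=
    Set.disjoint_left.2 fun ω h1 h2 => h1 h2.1
  have hunion := measure_mono (μ := P) (Set.union_subset (hsupp w 0)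
    (Set.inter_subset_right.trans (hsupp w 1) : {ω | h ω = 0} ∩ {ω | g' ω ≠ 0} ⊆ _))
  have h3 : P {ω | h ω ≠ 0} + P ({ω | h ω = 0} ∩ {ω | g' ω ≠ 0}) ≤ P {ω | h ω ≠ 0} := by
    rw [← measure_union' hdisj hZmeas.compl]
    exact hunion.trans hle
  exact h3.not_gt (ENNReal.lt_add_right (measure_ne_top _ _) hg'A)

end BoundedInProbability

lemma measure_lt_eq_zero_of_essSupR_lt {Ω : Type*} [MeasurableSpace Ω] {P : Measure Ω}
    {X : Ω → ℝ} {b M : ℝ} (hX : ∀ ω, X ω ≤ M) (h : essSupR P X < b) : P {ω | b < X ω} = 0 := by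
  obtain ⟨x, hx, hxb⟩ := exists_lt_of_csInf_lt
    (⟨M, by simp [(hX _).not_gt]⟩ : {x : ℝ | P {ω | x < X ω} = 0}.Nonempty) h
  exact measure_mono_null (fun ω (hω : b < X ω) => hxb.trans hω) hx

/-- **(d) implies (b) in the portmanteau theorem for ESFA's.**
If `L` is a convex cone of bounded random variables such that
`{P₀(X ∈ ·) : X ∈ L, X ≥ −1 a.s.}` is tight, then there are a σ-additive probability
`Q ~ P₀` and a constant `k ≥ 0` with `E_Q(X) ≤ k·ess sup(−X)` for every `X ∈ L`. -/
theorem stmt_8 {Ω : Type*} [MeasurableSpace Ω] (P₀ : Measure Ω) [IsProbabilityMeasure P₀]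
    (L : Set (Ω → ℝ)) (hLmeas : ∀ X ∈ L, Measurable X)
    (hLbdd : ∀ X ∈ L, ∃ M : ℝ, ∀ ω, |X ω| ≤ M)
    (hLadd : ∀ X ∈ L, ∀ Y ∈ L, X + Y ∈ L)
    (hLsmul : ∀ X ∈ L, ∀ c : ℝ, 0 ≤ c → c • X ∈ L)
    (htight : ∀ ε : ℝ, 0 < ε → ∃ M : ℝ, 0 < M ∧
      ∀ X ∈ L, (∀ᵐ ω ∂P₀, -1 ≤ X ω) → (P₀ {ω | M < |X ω|}).toReal < ε) :
    ∃ (Q : Measure Ω) (k : ℝ), IsProbabilityMeasure Q ∧ Q ≪ P₀ ∧ P₀ ≪ Q ∧ 0 ≤ k ∧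
      ∀ X ∈ L, ∫ ω, X ω ∂Q ≤ k * essSupR P₀ (fun ω => -X ω) := by
  rcases L.eq_empty_or_nonempty with rfl | ⟨X₀, hX₀⟩
  · exact ⟨P₀, 0, inferInstance, .rfl, .rfl, le_rfl, by simp⟩
  have hbound : ∀ X ∈ L, ∀ (μ : Measure Ω) [IsProbabilityMeasure μ], Integrable X μ := by
    intro X hX μ _
    obtain ⟨M, hM⟩ := hLbdd X hX
    exact .of_bound (hLmeas X hX).aestronglyMeasurable M (ae_of_all _ hM)
  set C : Set (Ω → ℝ) := {Y | Y - 1 ∈ L ∧ 0 ≤ᵐ[P₀] Y} with hC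
  have hmeas : ∀ Y ∈ C, Measurable Y := fun Y hY => by
    simpa using (hLmeas _ hY.1).add_const 1
  have hconv : Convex ℝ C := by
    rintro Y ⟨hY, hY0⟩ Z ⟨hZ, hZ0⟩ a b ha hb hab
    refine ⟨?_, ?_⟩
    · have h1 : a • Y + b • Z - 1 = a • (Y - 1) + b • (Z - 1) := by
        ext ω
        simp only [Pi.sub_apply, Pi.add_apply, Pi.smul_apply, smul_eq_mul, Pi.one_apply]
        linear_combination hab
      rw [h1]
      exact hLadd _ (hLsmul _ hY a ha) _ (hLsmul _ hZ b hb)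
    · filter_upwards [hY0, hZ0] with ω h1 h2
      exact add_nonneg (mul_nonneg ha h1) (mul_nonneg hb h2)
  have hL2 : ∀ Y ∈ C, MemLp Y 2 P₀ := by
    intro Y hY
    obtain ⟨M, hM⟩ := hLbdd _ hY.1
    refine .of_bound (hmeas Y hY).aestronglyMeasurable (M + 1) (ae_of_all _ fun ω => ?_)
    have := abs_le.1 (hM ω)
    simp only [Pi.sub_apply, Pi.one_apply] at this
    rw [Real.norm_eq_abs, abs_le]
    constructor <;> linarith
  have hone : 1 ∈ C := by
    refine ⟨?_, ae_of_all _ fun ω => zero_le_one⟩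
    simpa using hLsmul X₀ hX₀ 0 le_rfl
  have hCtight : ∀ ε : ℝ, 0 < ε → ∃ M : ℝ, 0 < M ∧
      ∀ Y ∈ C, (P₀ {ω | M < Y ω}).toReal < ε := by
    intro ε hε
    obtain ⟨M, hM, hML⟩ := htight ε hε
    refine ⟨M + 1, by linarith, fun Y hY => lt_of_le_of_lt ?_ (hML (Y - 1) hY.1 ?_)⟩
    · refine ENNReal.toReal_mono (measure_ne_top _ _) (measure_mono fun ω (hω : M + 1 < Y ω) => ?_)
      exact (lt_sub_iff_add_lt.2 hω).trans_le (le_abs_self ((Y - 1) ω))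
    · filter_upwards [hY.2] with ω hω
      simpa using hω
  obtain ⟨g, hgm, hgC, hg0⟩ :=
    exists_density_ae_ne_zero hconv hmeas hL2 (fun Y hY => hY.2) hone hCtight
  have hZ1 : ∫⁻ ω, g ω ∂P₀ ≤ 1 := by simpa using hgC 1 hone
  have hZ0 : ∫⁻ ω, g ω ∂P₀ ≠ 0 := by
    rw [Ne, lintegral_eq_zero_iff hgm]
    intro h
    obtain ⟨ω, h1, h2⟩ := (h.and hg0).exists
    exact h2 h1
  set Z := ∫⁻ ω, g ω ∂P₀ with hZ
  have hZtop : Z ≠ ∞ := ne_top_of_le_ne_top ENNReal.one_ne_top hZ1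
  set Q : Measure Ω := Z⁻¹ • P₀.withDensity g with hQ
  have hQprob : IsProbabilityMeasure Q := ⟨by
    simp [hQ, withDensity_apply, ← hZ, ENNReal.inv_mul_cancel hZ0 hZtop]⟩
  have hQP : Q ≪ P₀ := (withDensity_absolutelyContinuous P₀ g).smul_left _
  have hPQ : P₀ ≪ Q := (withDensity_absolutelyContinuous' hgm.aemeasurable hg0).trans
    (Measure.absolutelyContinuous_smul (ENNReal.inv_ne_zero.2 hZtop))
  have hk : ∀ X ∈ L, (∀ᵐ ω ∂P₀, -1 ≤ X ω) → ∫ ω, X ω ∂Q ≤ Z⁻¹.toReal := by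
    intro X hX hX1
    have hXC : X + 1 ∈ C := ⟨by simpa using hX, by
      filter_upwards [hX1] with ω hω
      simp only [Pi.zero_apply, Pi.add_apply, Pi.one_apply]
      linarith⟩
    have h1 : ∫ ω, (X + 1) ω ∂Q = ∫ ω, X ω ∂Q + 1 := by
      simp [integral_add (hbound X hX Q) (integrable_const 1)]
    have h2 : ∫ ω, (X + 1) ω ∂Q ≤ Z⁻¹.toReal := by
      rw [integral_eq_lintegral_of_nonneg_ae (hQP.ae_le hXC.2)
        (hmeas _ hXC).aestronglyMeasurable]
      refine ENNReal.toReal_mono (ENNReal.inv_ne_top.2 hZ0) ?_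
      rw [hQ, lintegral_smul_measure,
        lintegral_withDensity_eq_lintegral_mul _ hgm (hmeas _ hXC).ennreal_ofReal]
      exact mul_le_of_le_one_right' (hgC _ hXC)
    linarith
  refine ⟨Q, Z⁻¹.toReal, hQprob, hQP, hPQ, ENNReal.toReal_nonneg, fun X hX => ?_⟩
  set a := essSupR P₀ fun ω => -X ω with ha
  have hab : ∀ b, a < b → ∀ᵐ ω ∂P₀, -b ≤ X ω := by
    intro b hb
    obtain ⟨M, hM⟩ := hLbdd X hX
    have h1 := measure_lt_eq_zero_of_essSupR_lt
      (fun ω => (neg_le_abs (X ω)).trans (hM ω)) hb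
    filter_upwards [measure_eq_zero_iff_ae_notMem.1 h1] with ω hω
    simp only [not_lt] at hω
    linarith
  have hscale : ∀ c : ℝ, 0 ≤ c → (∀ᵐ ω ∂P₀, -1 ≤ c * X ω) → c * ∫ ω, X ω ∂Q ≤ Z⁻¹.toReal := by
    intro c hc h
    rw [← integral_const_mul]
    exact hk (c • X) (hLsmul X hX c hc) h
  have ha0 : 0 ≤ a := by
    by_contra! hneg
    have hX0 : ∀ᵐ ω ∂P₀, -(a / 2) ≤ X ω := hab (a / 2) (by linarith)
    have hpos : -(a / 2) ≤ ∫ ω, X ω ∂Q := by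
      have := integral_mono_ae (integrable_const (-(a / 2))) (hbound X hX Q) (hQP.ae_le hX0)
      simpa using this
    obtain ⟨n, hn⟩ := exists_nat_gt (Z⁻¹.toReal / (∫ ω, X ω ∂Q))
    rw [div_lt_iff₀ (by linarith)] at hn
    refine hn.not_ge (hscale n n.cast_nonneg ?_)
    filter_upwards [hX0] with ω hω
    have : (0 : ℝ) ≤ n * X ω := mul_nonneg n.cast_nonneg (by linarith)
    linarith
  have hle : ∀ b, a < b → ∫ ω, X ω ∂Q ≤ Z⁻¹.toReal * b := by
    intro b hb
    have hb0 : 0 < b := ha0.trans_lt hb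
    rw [← div_le_iff₀ hb0, div_eq_inv_mul]
    refine hscale b⁻¹ (inv_nonneg.2 hb0.le) ?_
    filter_upwards [hab b hb] with ω hω
    rw [← div_eq_inv_mul, le_div_iff₀ hb0]
    linarith
  refine ge_of_tendsto (((continuous_const.mul continuous_id).tendsto a).mono_left
    (nhdsWithin_le_nhds (s := Set.Ioi a))) ?_
  filter_upwards [self_mem_nhdsWithin] with b hb using hle b hb
end

section
/- Let L be a convex cone of real bounded random variables on (Ω, 𝒜, P₀), and suppose there exist a σ-additive probability measure Q on 𝒜 with Q ~ P₀ and a constant k ≥ 0 such that E_Q(X) ≤ k·ess sup(−X) for every X ∈ L. Then there exists a monotone normalized linear functional ℓ₁ : B → ℝ with ℓ₁(1_A) = 0 whenever P₀(A) = 0, such that the functional ℓ defined by ℓ(f) = (E_Q(f) + k·ℓ₁(f))/(1 + k) is a monotone normalized linear functional on B satisfying ℓ ~ P₀ and ℓ(X) ≤ 0 for every X ∈ L. -/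
open MeasureTheory Filter Topology

/-- A bounded measurable real function on `Ω`: an element of the space `B`. -/
def IsBddMeas {Ω : Type*} [MeasurableSpace Ω] (f : Ω → ℝ) : Prop :=
  Measurable f ∧ ∃ M : ℝ, ∀ ω, |f ω| ≤ M

/-- A finitely additive probability on `𝒜`, encoded as a functional on functions
`Ω → ℝ` that is linear and monotone on the space `B` of bounded measurable functions
and normalized (`ℓ(1) = 1`). -/
def IsFAP {Ω : Type*} [MeasurableSpace Ω] (ℓ : (Ω → ℝ) → ℝ) : Prop :=
  (∀ f g : Ω → ℝ, IsBddMeas f → IsBddMeas g → ℓ (f + g) = ℓ f + ℓ g) ∧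
  (∀ (c : ℝ) (f : Ω → ℝ), IsBddMeas f → ℓ (c • f) = c * ℓ f) ∧
  (∀ f g : Ω → ℝ, IsBddMeas f → IsBddMeas g → (∀ ω, f ω ≤ g ω) → ℓ f ≤ ℓ g) ∧
  ℓ (fun _ => 1) = 1

/-- The space `B` of bounded measurable real functions, as a subspace of all functions. -/
def bddMeas (Ω : Type*) [MeasurableSpace Ω] : Submodule ℝ (Ω → ℝ) where
  carrier := {f | IsBddMeas f}
  add_mem' := by
    rintro f g ⟨hf, M, hM⟩ ⟨hg, N, hN⟩
    exact ⟨hf.add hg, M + N, fun ω => (abs_add_le _ _).trans (add_le_add (hM ω) (hN ω))⟩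
  zero_mem' := ⟨measurable_const, 0, fun ω => by simp⟩
  smul_mem' := by
    rintro c f ⟨hf, M, hM⟩
    refine ⟨hf.const_smul c, |c| * M, fun ω => ?_⟩
    simpa [abs_mul] using mul_le_mul_of_nonneg_left (hM ω) (abs_nonneg c)

lemma isBddMeas_const {Ω : Type*} [MeasurableSpace Ω] (c : ℝ) :
    IsBddMeas (fun _ : Ω => c) :=
  ⟨measurable_const, |c|, fun _ => le_rfl⟩

lemma isBddMeas_indicator_one {Ω : Type*} [MeasurableSpace Ω] {A : Set Ω}
    (hA : MeasurableSet A) : IsBddMeas (A.indicator fun _ => (1 : ℝ)) := by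
  refine ⟨measurable_const.indicator hA, 1, fun ω => ?_⟩
  by_cases h : ω ∈ A <;> simp [h]

lemma IsBddMeas.integrable {Ω : Type*} [MeasurableSpace Ω] {f : Ω → ℝ} (hf : IsBddMeas f)
    (Q : Measure Ω) [IsFiniteMeasure Q] : Integrable f Q := by
  obtain ⟨hm, M, hM⟩ := hf
  exact .of_bound hm.aestronglyMeasurable M (.of_forall hM)

lemma isFAP_integral {Ω : Type*} [MeasurableSpace Ω] (Q : Measure Ω) [IsProbabilityMeasure Q] :
    IsFAP fun f : Ω → ℝ => ∫ ω, f ω ∂Q :=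
  ⟨fun _ _ hf hg => integral_add (hf.integrable Q) (hg.integrable Q),
    fun c f _ => integral_const_mul c f,
    fun _ _ hf hg h => integral_mono (hf.integrable Q) (hg.integrable Q) h,
    by simp⟩

lemma IsFAP.convex_comb {Ω : Type*} [MeasurableSpace Ω] {ℓ₁ ℓ₂ : (Ω → ℝ) → ℝ}
    (h₁ : IsFAP ℓ₁) (h₂ : IsFAP ℓ₂) {k : ℝ} (hk : 0 ≤ k) :
    IsFAP fun f => (ℓ₁ f + k * ℓ₂ f) / (1 + k) := by
  obtain ⟨a₁, s₁, m₁, n₁⟩ := h₁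
  obtain ⟨a₂, s₂, m₂, n₂⟩ := h₂
  refine ⟨fun f g hf hg => ?_, fun c f hf => ?_, fun f g hf hg h => ?_, ?_⟩
  · simp only [a₁ f g hf hg, a₂ f g hf hg]
    ring
  · simp only [s₁ c f hf, s₂ c f hf]
    ring
  · have := m₁ f g hf hg h
    have := m₂ f g hf hg h
    dsimp only
    gcongr
  · simp only [n₁, n₂]
    field_simp

lemma integral_indicator_one_eq_zero_iff {Ω : Type*} [MeasurableSpace Ω] (Q : Measure Ω)
    [IsFiniteMeasure Q] {A : Set Ω} (hA : MeasurableSet A) :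
    ∫ ω, A.indicator (fun _ => (1 : ℝ)) ω ∂Q = 0 ↔ Q A = 0 := by
  rw [integral_indicator hA]
  simp [Measure.real, ENNReal.toReal_eq_zero_iff]

lemma essSupR_le_of_ae_le {Ω : Type*} [MeasurableSpace Ω] {P₀ : Measure Ω}
    [IsProbabilityMeasure P₀] {X : Ω → ℝ} {M a : ℝ} (hM : ∀ ω, M ≤ X ω)
    (ha : ∀ᵐ ω ∂P₀, X ω ≤ a) : essSupR P₀ X ≤ a := by
  refine csInf_le ⟨M, fun x hx => ?_⟩ ?_
  · by_contra! hlt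
    have huniv : {ω | x < X ω} = Set.univ := Set.eq_univ_of_forall fun ω => hlt.trans_le (hM ω)
    rw [Set.mem_ofPred_eq, huniv, measure_univ] at hx
    exact one_ne_zero hx
  · simpa [ae_iff] using ha

/-- A convex cone of bounded measurable functions none of which is essentially bounded below by
a positive constant is nonpositive under some finitely additive probability vanishing on null
sets. -/
theorem exists_isFAP_nonpos {Ω : Type*} [MeasurableSpace Ω] (P₀ : Measure Ω)
    [IsProbabilityMeasure P₀] (S : Set (Ω → ℝ)) (hSB : ∀ Y ∈ S, IsBddMeas Y)
    (hzero : (0 : Ω → ℝ) ∈ S) (hadd : ∀ Y ∈ S, ∀ Z ∈ S, Y + Z ∈ S)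
    (hsmul : ∀ Y ∈ S, ∀ c : ℝ, 0 ≤ c → c • Y ∈ S)
    (hS : ∀ Y ∈ S, ∀ c : ℝ, (∀ᵐ ω ∂P₀, c ≤ Y ω) → c ≤ 0) :
    ∃ ℓ : (Ω → ℝ) → ℝ, IsFAP ℓ ∧
      (∀ A : Set Ω, MeasurableSet A → P₀ A = 0 → ℓ (A.indicator fun _ => (1 : ℝ)) = 0) ∧
      ∀ Y ∈ S, ℓ Y ≤ 0 := by
  classical
  have : Nonempty Ω := P₀.nonempty_of_neZero
  let s : PointedCone ℝ (bddMeas Ω) :=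
    { carrier := {f | ∃ Y ∈ S, ∀ᵐ ω ∂P₀, 0 ≤ f.1 ω + Y ω}
      smul_mem' := by
        rintro ⟨c, hc⟩ f ⟨Y, hY, h⟩
        refine ⟨c • Y, hsmul Y hY c hc, h.mono fun ω hω => ?_⟩
        exact (mul_nonneg hc hω).trans_eq (mul_add c _ _)
      zero_mem' := ⟨0, hzero, by simp⟩
      add_mem' := by
        rintro f g ⟨Y, hY, hf⟩ ⟨Z, hZ, hg⟩
        refine ⟨Y + Z, hadd Y hY Z hZ, ?_⟩
        filter_upwards [hf, hg] with ω h₁ h₂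
        have := add_nonneg h₁ h₂
        simp only [Submodule.coe_add, Pi.add_apply]
        linarith }
  have mem_of_ae_nonneg : ∀ f : bddMeas Ω, (∀ᵐ ω ∂P₀, 0 ≤ f.1 ω) → f ∈ s := fun f hf =>
    ⟨0, hzero, hf.mono fun ω hω => by simpa using hω⟩
  let e : bddMeas Ω := ⟨fun _ => 1, isBddMeas_const 1⟩
  have he : e ≠ 0 := by
    intro h
    have := congrFun (congrArg Subtype.val h) (Classical.arbitrary Ω)
    simp [e] at this
  let φ : bddMeas Ω →ₗ.[ℝ] ℝ := LinearPMap.mkSpanSingleton e 1 he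
  have hφ : ∀ (c : ℝ) (hc : c • e ∈ φ.domain), φ ⟨c • e, hc⟩ = c := fun c hc =>
    (LinearPMap.mkSpanSingleton'_apply e (1 : ℝ) _ c hc).trans (mul_one c)
  have hdom : ∀ c : ℝ, c • e ∈ φ.domain := fun c =>
    Submodule.smul_mem _ c (Submodule.mem_span_singleton_self e)
  obtain ⟨g, hg, hgs⟩ := riesz_extension s φ
    (by
      rintro ⟨x, hx⟩ hxs
      obtain ⟨c, rfl⟩ := Submodule.mem_span_singleton.1 hx
      obtain ⟨Y, hY, h⟩ := hxs
      have := hS Y hY (-c) (h.mono fun ω hω => by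
        simp [e] at hω
        linarith)
      rw [hφ]
      linarith)
    (by
      rintro ⟨y, hy, M, hM⟩
      refine ⟨⟨M • e, hdom M⟩, mem_of_ae_nonneg _ (.of_forall fun ω => ?_)⟩
      have := neg_le_of_abs_le (hM ω)
      simp [e]
      linarith)
  have hge : g e = 1 := by
    have := (hg ⟨(1 : ℝ) • e, hdom 1⟩).trans (hφ 1 (hdom 1))
    simpa using this
  have hg_mono : ∀ f h : bddMeas Ω, (∀ᵐ ω ∂P₀, f.1 ω ≤ h.1 ω) → g f ≤ g h := fun f h hfh => by
    have := hgs (h - f) (mem_of_ae_nonneg _ (hfh.mono fun ω hω => by simpa using hω))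
    rw [map_sub] at this
    linarith
  let ℓ : (Ω → ℝ) → ℝ := fun f => if hf : IsBddMeas f then g ⟨f, hf⟩ else 0
  have hℓ : ∀ f (hf : IsBddMeas f), ℓ f = g ⟨f, hf⟩ := fun f hf => dif_pos hf
  refine ⟨ℓ, ⟨fun f h hf hh => ?_, fun c f hf => ?_, fun f h hf hh hfh => ?_, ?_⟩,
    fun A hA hA0 => ?_, fun Y hY => ?_⟩
  · rw [hℓ f hf, hℓ h hh, hℓ _ ((bddMeas Ω).add_mem hf hh), ← map_add]
    rfl
  · rw [hℓ f hf, hℓ _ ((bddMeas Ω).smul_mem c hf), ← smul_eq_mul, ← map_smul]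
    rfl
  · rw [hℓ f hf, hℓ h hh]
    exact hg_mono _ _ (.of_forall hfh)
  · rw [hℓ _ (isBddMeas_const 1)]
    exact hge
  · rw [hℓ _ (isBddMeas_indicator_one hA), ← map_zero g]
    have hae : ∀ᵐ ω ∂P₀, A.indicator (fun _ => (1 : ℝ)) ω = 0 := by
      filter_upwards [measure_eq_zero_iff_ae_notMem.1 hA0] with ω hω
      simp [hω]
    exact le_antisymm (hg_mono _ _ (hae.mono fun ω hω => hω.le))
      (hg_mono _ _ (hae.mono fun ω hω => hω.ge))
  · rw [hℓ Y (hSB Y hY)]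
    have := hgs (-⟨Y, hSB Y hY⟩) ⟨Y, hY, .of_forall fun ω => by simp⟩
    rw [map_neg] at this
    linarith

/-- The finitely additive part in the decomposition: `E_Q + k·ℓ₁` is nonpositive on `L`. -/
lemma exists_isFAP_integral_add_mul_nonpos {Ω : Type*} [MeasurableSpace Ω] (P₀ : Measure Ω)
    [IsProbabilityMeasure P₀] (L : Set (Ω → ℝ)) (hL : ∀ X ∈ L, IsBddMeas X)
    (hLadd : ∀ X ∈ L, ∀ Y ∈ L, X + Y ∈ L)
    (hLsmul : ∀ X ∈ L, ∀ c : ℝ, 0 ≤ c → c • X ∈ L)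
    (Q : Measure Ω) [IsProbabilityMeasure Q] (hQ₁ : Q ≪ P₀) (k : ℝ) (hk : 0 ≤ k)
    (hb : ∀ X ∈ L, ∫ ω, X ω ∂Q ≤ k * essSupR P₀ (fun ω => -X ω)) :
    ∃ ℓ₁ : (Ω → ℝ) → ℝ, IsFAP ℓ₁ ∧
      (∀ A : Set Ω, MeasurableSet A → P₀ A = 0 → ℓ₁ (A.indicator fun _ => (1 : ℝ)) = 0) ∧
      ∀ X ∈ L, ∫ ω, X ω ∂Q + k * ℓ₁ X ≤ 0 := by
  by_cases htriv : k = 0 ∨ L = ∅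
  · refine ⟨fun f => ∫ ω, f ω ∂Q, isFAP_integral Q,
      fun A hA hA0 => (integral_indicator_one_eq_zero_iff Q hA).2 (hQ₁ hA0), fun X hX => ?_⟩
    rcases htriv with rfl | rfl
    · simpa using hb X hX
    · exact hX.elim
  push Not at htriv
  obtain ⟨hk0, X₀, hX₀⟩ := htriv
  have hkpos : 0 < k := lt_of_le_of_ne hk hk0.symm
  let T : (Ω → ℝ) → Ω → ℝ := fun X => X + fun _ => (∫ ω, X ω ∂Q) / k
  have hT_smul : ∀ (X : Ω → ℝ) (c : ℝ), T (c • X) = c • T X := fun X c => by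
    ext ω
    simp only [T, Pi.add_apply, Pi.smul_apply, smul_eq_mul, integral_const_mul]
    ring
  obtain ⟨ℓ₁, hℓ₁, hnull, hneg⟩ := exists_isFAP_nonpos P₀ (T '' L)
    (by
      rintro _ ⟨X, hX, rfl⟩
      exact (bddMeas Ω).add_mem (hL X hX) (isBddMeas_const _))
    ⟨(0 : ℝ) • X₀, hLsmul X₀ hX₀ 0 le_rfl, by rw [hT_smul, zero_smul]⟩
    (by
      rintro _ ⟨X, hX, rfl⟩ _ ⟨Y, hY, rfl⟩
      refine ⟨X + Y, hLadd X hX Y hY, ?_⟩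
      ext ω
      simp only [T, Pi.add_apply,
        integral_add ((hL X hX).integrable Q) ((hL Y hY).integrable Q)]
      ring)
    (by
      rintro _ ⟨X, hX, rfl⟩ c hc
      exact ⟨c • X, hLsmul X hX c hc, hT_smul X c⟩)
    (by
      rintro _ ⟨X, hX, rfl⟩ c hc
      obtain ⟨M, hM⟩ := (hL X hX).2
      have hsup : essSupR P₀ (fun ω => -X ω) ≤ (∫ ω, X ω ∂Q) / k - c :=
        essSupR_le_of_ae_le (M := -M) (fun ω => neg_le_neg (le_of_abs_le (hM ω)))
          (hc.mono fun ω hω => by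
            simp only [T, Pi.add_apply] at hω
            linarith)
      have hle := (div_le_iff₀' hkpos).2 (hb X hX)
      linarith)
  refine ⟨ℓ₁, hℓ₁, hnull, fun X hX => ?_⟩
  obtain ⟨ℓ_add, ℓ_smul, -, ℓ_one⟩ := hℓ₁
  have hconst : ∀ c : ℝ, ℓ₁ (fun _ => c) = c := fun c => by
    have := ℓ_smul c _ (isBddMeas_const 1)
    rw [ℓ_one, mul_one] at this
    convert this using 2
    ext ω
    simp
  have h := hneg _ ⟨X, hX, rfl⟩
  simp only [T] at h
  rw [ℓ_add _ _ (hL X hX) (isBddMeas_const _), hconst] at h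
  have := mul_nonpos_of_nonneg_of_nonpos hk h
  rw [mul_add, mul_div_cancel₀ _ hk0] at this
  linarith

/-- **Last part of the portmanteau theorem for ESFA's.**
If `L` is a convex cone of bounded random variables and condition (b) holds for some
`Q ~ P₀` and `k ≥ 0`, then an ESFA is `ℓ = (E_Q + k·ℓ₁)/(1 + k)` for a suitable finitely
additive probability `ℓ₁` vanishing on `P₀`-null events. -/
theorem stmt_9 {Ω : Type*} [MeasurableSpace Ω] (P₀ : Measure Ω) [IsProbabilityMeasure P₀]
    (L : Set (Ω → ℝ)) (hLmeas : ∀ X ∈ L, Measurable X)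
    (hLbdd : ∀ X ∈ L, ∃ M : ℝ, ∀ ω, |X ω| ≤ M)
    (hLadd : ∀ X ∈ L, ∀ Y ∈ L, X + Y ∈ L)
    (hLsmul : ∀ X ∈ L, ∀ c : ℝ, 0 ≤ c → c • X ∈ L)
    (Q : Measure Ω) [IsProbabilityMeasure Q] (hQ₁ : Q ≪ P₀) (hQ₂ : P₀ ≪ Q)
    (k : ℝ) (hk : 0 ≤ k)
    (hb : ∀ X ∈ L, ∫ ω, X ω ∂Q ≤ k * essSupR P₀ (fun ω => -X ω)) :
    ∃ ℓ₁ ℓ : (Ω → ℝ) → ℝ, IsFAP ℓ₁ ∧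
      (∀ A : Set Ω, MeasurableSet A → P₀ A = 0 →
        ℓ₁ (A.indicator fun _ => (1 : ℝ)) = 0) ∧
      ℓ = (fun f => (∫ ω, f ω ∂Q + k * ℓ₁ f) / (1 + k)) ∧
      IsFAP ℓ ∧
      (∀ A : Set Ω, MeasurableSet A →
        (ℓ (A.indicator fun _ => (1 : ℝ)) = 0 ↔ P₀ A = 0)) ∧
      ∀ X ∈ L, ℓ X ≤ 0 := by
  have hL : ∀ X ∈ L, IsBddMeas X := fun X hX => ⟨hLmeas X hX, hLbdd X hX⟩
  obtain ⟨ℓ₁, hℓ₁, hnull, hneg⟩ :=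
    exists_isFAP_integral_add_mul_nonpos P₀ L hL hLadd hLsmul Q hQ₁ k hk hb
  refine ⟨ℓ₁, _, hℓ₁, hnull, rfl, (isFAP_integral Q).convex_comb hℓ₁ hk,
    fun A hA => ⟨fun h => ?_, fun h => ?_⟩,
    fun X hX => div_nonpos_of_nonpos_of_nonneg (hneg X hX) (by linarith)⟩
  · have hind : ∀ ω, (0 : ℝ) ≤ A.indicator (fun _ => (1 : ℝ)) ω :=
      Set.indicator_nonneg fun _ _ => zero_le_one
    have hℓ₁_nonneg : 0 ≤ ℓ₁ (A.indicator fun _ => (1 : ℝ)) := by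
      have h₀ := hℓ₁.2.1 0 _ (isBddMeas_const 1)
      rw [zero_mul, zero_smul] at h₀
      rw [← h₀]
      exact hℓ₁.2.2.1 _ _ (isBddMeas_const 0) (isBddMeas_indicator_one hA) hind
    have hmul := mul_nonneg hk hℓ₁_nonneg
    have hint : 0 ≤ ∫ ω, A.indicator (fun _ => (1 : ℝ)) ω ∂Q := integral_nonneg hind
    have hsum := (div_eq_zero_iff.1 h).resolve_right (by linarith)
    exact hQ₂ ((integral_indicator_one_eq_zero_iff Q hA).1 (by linarith))
  · simp only [hnull A hA h, (integral_indicator_one_eq_zero_iff Q hA).2 (hQ₁ h)]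
    simp
end

section
/- Let X₁, …, X_d be real random variables on (Ω, 𝒜, P₀) and let L = {∑_{j=1}^d b_j X_j : b₁, …, b_d ∈ ℝ} be the linear space they generate. Suppose the no-arbitrage condition holds: every X ∈ L with X ≥ 0 P₀-a.s. satisfies X = 0 P₀-a.s. Then there exists a σ-additive probability measure P on 𝒜 with P ~ P₀ such that each X_j is P-integrable and E_P(X_j) = 0 for j = 1, …, d. -/
open MeasureTheory Filter Topology

/-- If the integral of `f` against every perturbation `(1 - t) + 2 t 𝟙_A` of the constant `1` is
positive, then `f` is almost everywhere nonnegative. -/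
lemma ae_nonneg_of_forall_perturbation_pos {Ω : Type*} [MeasurableSpace Ω] {μ : Measure Ω}
    {f : Ω → ℝ} (hf : Integrable f μ)
    (h : ∀ t : ℝ, 0 < t → t < 1 → ∀ A : Set Ω, MeasurableSet A →
      0 < ∫ ω, ((1 - t) + 2 * t * A.indicator 1 ω) * f ω ∂μ) :
    0 ≤ᵐ[μ] f := by
  refine ae_nonneg_of_forall_setIntegral_nonneg hf fun A hA _ => ?_
  have key : ∀ t : ℝ, ∫ ω, ((1 - t) + 2 * t * A.indicator 1 ω) * f ω ∂μ
      = (1 - t) * ∫ ω, f ω ∂μ + 2 * t * ∫ ω in A, f ω ∂μ := by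
    intro t
    rw [← integral_indicator hA, ← integral_const_mul, ← integral_const_mul,
      ← integral_add (hf.const_mul _) ((hf.indicator hA).const_mul _)]
    congr 1 with ω
    by_cases hω : ω ∈ A <;> simp [hω] <;> ring
  set a := ∫ ω in A, f ω ∂μ
  set I := ∫ ω, f ω ∂μ
  by_contra! ha
  have hI := le_abs_self I
  have hI' := abs_nonneg I
  have hD : 0 < |I| - 2 * a := by linarith
  set s := -a / (|I| - 2 * a) with hs
  have hs0 : 0 < s := div_pos (by linarith) hD
  have hs1 : s < 1 := (div_lt_one hD).2 (by linarith)
  have hsD : s * (|I| - 2 * a) = -a := div_mul_cancel₀ _ hD.ne'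
  have := h (1 - s) (by linarith) (by linarith) A hA
  rw [key] at this
  nlinarith [mul_le_mul_of_nonneg_left hI hs0.le]

lemma ae_norm_le_norm_Lp_top {Ω : Type*} [MeasurableSpace Ω] {μ : Measure Ω}
    (g : Lp ℝ ⊤ μ) : ∀ᵐ ω ∂μ, ‖g ω‖ ≤ ‖g‖ := by
  have := ae_le_lpNorm_exponent_top (Lp.memLp g)
  rwa [← toReal_eLpNorm (Lp.aestronglyMeasurable g), ← Lp.norm_def] at this

lemma Lp_top_integrable_mul {Ω : Type*} [MeasurableSpace Ω] {μ : Measure Ω}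
    (g : Lp ℝ ⊤ μ) {f : Ω → ℝ} (hf : Integrable f μ) : Integrable (fun ω => g ω * f ω) μ :=
  hf.bdd_mul (Lp.aestronglyMeasurable g) (ae_norm_le_norm_Lp_top g)

/-- Integration against a fixed integrable function, as a linear functional on `L^∞`. -/
noncomputable def integralMulLp {Ω : Type*} [MeasurableSpace Ω] {μ : Measure Ω}
    (f : Ω → ℝ) (hf : Integrable f μ) : Lp ℝ ⊤ μ →ₗ[ℝ] ℝ where
  toFun g := ∫ ω, g ω * f ω ∂μ
  map_add' g h := by
    rw [← integral_add (Lp_top_integrable_mul g hf) (Lp_top_integrable_mul h hf)]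
    refine integral_congr_ae ?_
    filter_upwards [Lp.coeFn_add g h] with ω hω
    rw [hω, Pi.add_apply, add_mul]
  map_smul' c g := by
    rw [RingHom.id_apply, smul_eq_mul, ← integral_const_mul]
    refine integral_congr_ae ?_
    filter_upwards [Lp.coeFn_smul c g] with ω hω
    rw [hω, Pi.smul_apply, smul_eq_mul, mul_assoc]

/-- Under no arbitrage, finitely many integrable functions are simultaneously centred by some
bounded positive density. -/
lemma exists_pos_integral_mul_eq_zero {Ω ι : Type*} [MeasurableSpace Ω] [Fintype ι]
    {μ : Measure Ω} [IsProbabilityMeasure μ] {Y : ι → Ω → ℝ} (hY : ∀ j, Integrable (Y j) μ)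
    (hNA : ∀ b : ι → ℝ,
      (∀ᵐ ω ∂μ, 0 ≤ ∑ j, b j * Y j ω) → (∀ᵐ ω ∂μ, ∑ j, b j * Y j ω = 0)) :
    ∃ g : Ω → ℝ, Measurable g ∧ (∀ᵐ ω ∂μ, 0 < g ω ∧ g ω < 2) ∧
      ∀ j, ∫ ω, g ω * Y j ω ∂μ = 0 := by
  have h1 : MemLp (fun _ : Ω => (1 : ℝ)) ⊤ μ := memLp_const 1
  let T : ι → Lp ℝ ⊤ μ →ₗ[ℝ] ℝ := fun j => integralMulLp (Y j) (hY j)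
  let N : Submodule ℝ (Lp ℝ ⊤ μ) := ⨅ j, LinearMap.ker (T j)
  let U : Set (Lp ℝ ⊤ μ) := Metric.ball (h1.toLp _) 1
  by_cases hdisj : Disjoint U (N : Set (Lp ℝ ⊤ μ))
  · exfalso
    obtain ⟨f, s, hfU, hfN⟩ := geometric_hahn_banach_open (convex_ball _ _) Metric.isOpen_ball
      N.convex hdisj
    have hs : s ≤ 0 := by simpa using hfN 0 N.zero_mem
    have hker : N ≤ LinearMap.ker (-f : StrongDual ℝ (Lp ℝ ⊤ μ)).toLinearMap := by
      intro n hn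
      by_contra hne
      have hne' : f n ≠ 0 := by simpa using hne
      have := hfN (((s - 1) / f n) • n) (N.smul_mem _ hn)
      rw [map_smul, smul_eq_mul, div_mul_cancel₀ _ hne'] at this
      linarith
    obtain ⟨b, hb⟩ := (Submodule.mem_span_range_iff_exists_fun ℝ).1
      (mem_span_of_iInf_ker_le_ker hker)
    have hZint : Integrable (fun ω => ∑ j, b j * Y j ω) μ :=
      integrable_finsetSum _ fun j _ => (hY j).const_mul _
    have hrep : ∀ u : Lp ℝ ⊤ μ, -f u = ∫ ω, u ω * ∑ j, b j * Y j ω ∂μ := by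
      intro u
      have h2 := LinearMap.congr_fun hb u
      simp only [LinearMap.sum_apply, LinearMap.smul_apply, smul_eq_mul] at h2
      change _ = -f u at h2
      rw [← h2]
      simp_rw [Finset.mul_sum, mul_left_comm _ (b _)]
      rw [integral_finsetSum _ fun j _ => (Lp_top_integrable_mul u (hY j)).const_mul _]
      simp_rw [integral_const_mul]
      rfl
    have hpos : ∀ u ∈ U, 0 < ∫ ω, u ω * ∑ j, b j * Y j ω ∂μ := by
      intro u hu
      rw [← hrep]
      linarith [hfU u hu]
    have hnonneg := ae_nonneg_of_forall_perturbation_pos hZint (by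
      intro t ht0 ht1 A hA
      have hm : Measurable fun ω => (1 - t) + 2 * t * A.indicator (1 : Ω → ℝ) ω :=
        measurable_const.add (measurable_const.mul (measurable_one.indicator hA))
      have hu : MemLp (fun ω => (1 - t) + 2 * t * A.indicator (1 : Ω → ℝ) ω) ⊤ μ := by
        refine memLp_top_of_bound hm.aestronglyMeasurable 2 (.of_forall fun ω => ?_)
        rw [Real.norm_eq_abs, abs_le]
        by_cases hω : ω ∈ A <;> simp [hω] <;> constructor <;> linarith
      have hmem : hu.toLp _ ∈ U := by
        rw [Metric.mem_ball, dist_eq_norm]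
        refine lt_of_le_of_lt (b := t) ?_ ht1
        rw [← MemLp.toLp_sub]
        have := Lp.norm_le_of_ae_bound (f := (hu.sub h1).toLp _) ht0.le (by
          filter_upwards [(hu.sub h1).coeFn_toLp] with ω hω
          rw [hω, Real.norm_eq_abs, abs_le]
          by_cases hω : ω ∈ A <;> simp [hω] <;> (try constructor) <;> linarith)
        simpa using this
      refine (hpos _ hmem).trans_eq (integral_congr_ae ?_)
      filter_upwards [hu.coeFn_toLp] with ω hω
      rw [hω])
    have hzero := hNA b hnonneg
    have := hpos (h1.toLp _) (Metric.mem_ball_self one_pos)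
    rw [integral_eq_zero_of_ae] at this
    · exact lt_irrefl _ this
    · filter_upwards [hzero] with ω hω
      simp [hω]
  · obtain ⟨g, hgU, hgN⟩ := Set.not_disjoint_iff.1 hdisj
    refine ⟨g, (Lp.stronglyMeasurable g).measurable, ?_, fun j => ?_⟩
    · filter_upwards [ae_norm_le_norm_Lp_top (g - h1.toLp _), Lp.coeFn_sub g (h1.toLp _),
        h1.coeFn_toLp] with ω ha hb hc
      rw [Metric.mem_ball, dist_eq_norm] at hgU
      rw [hb, Pi.sub_apply, hc] at ha
      have := abs_lt.1 (ha.trans_lt hgU)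
      constructor <;> linarith [this.1, this.2]
    · exact (Submodule.mem_iInf _).1 hgN j

/-- **Finite dimensional FTAP.**
Let `X₁, …, X_d` be random variables and `L` the linear space they generate. If the
no-arbitrage condition holds (every `X ∈ L` with `X ≥ 0` a.s. satisfies `X = 0` a.s.),
then there is a σ-additive probability `P ~ P₀` with each `X_j` `P`-integrable and
`E_P(X_j) = 0` for all `j`. -/
theorem stmt_14 {Ω : Type*} [MeasurableSpace Ω] (P₀ : Measure Ω) [IsProbabilityMeasure P₀]
    (d : ℕ) (X : Fin d → Ω → ℝ) (hXmeas : ∀ j, Measurable (X j))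
    (hNA : ∀ b : Fin d → ℝ,
      (∀ᵐ ω ∂P₀, 0 ≤ ∑ j, b j * X j ω) → (∀ᵐ ω ∂P₀, ∑ j, b j * X j ω = 0)) :
    ∃ P : Measure Ω, IsProbabilityMeasure P ∧ P ≪ P₀ ∧ P₀ ≪ P ∧
      ∀ j, Integrable (X j) P ∧ ∫ ω, X j ω ∂P = 0 := by
  let S : Ω → ℝ := fun ω => ∑ j, |X j ω|
  let w : Ω → ℝ := fun ω => (1 + S ω)⁻¹
  have hS : ∀ ω, 0 ≤ S ω := fun ω => Finset.sum_nonneg fun j _ => abs_nonneg _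
  have hw : ∀ ω, 0 < w ω := fun ω => inv_pos.2 (by linarith [hS ω])
  have hw1 : ∀ ω, w ω ≤ 1 := fun ω => inv_le_one_of_one_le₀ (by linarith [hS ω])
  have hwm : Measurable w :=
    (measurable_const.add (Finset.measurable_fun_sum _ fun j _ => (hXmeas j).abs)).inv
  have hYint : ∀ j, Integrable (fun ω => w ω * X j ω) P₀ := fun j => by
    refine Integrable.of_bound (hwm.mul (hXmeas j)).aestronglyMeasurable 1 (.of_forall fun ω => ?_)
    have hle : |X j ω| ≤ S ω :=
      Finset.single_le_sum (f := fun j => |X j ω|) (fun j _ => abs_nonneg _) (Finset.mem_univ j)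
    rw [Real.norm_eq_abs, abs_mul, abs_of_pos (hw ω)]
    exact (inv_mul_le_one₀ (by linarith [hS ω])).2 (by linarith)
  have hsum : ∀ (b : Fin d → ℝ) ω,
      ∑ j, b j * (w ω * X j ω) = w ω * ∑ j, b j * X j ω := fun b ω => by
    simp_rw [Finset.mul_sum, mul_left_comm]
  obtain ⟨g, hgm, hg, hgY⟩ := exists_pos_integral_mul_eq_zero hYint (by
    intro b hb
    have := hNA b (by
      filter_upwards [hb] with ω hω
      rw [hsum] at hω
      exact nonneg_of_mul_nonneg_right hω (hw ω))
    filter_upwards [this] with ω hω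
    rw [hsum, hω, mul_zero])
  have hgb : ∀ᵐ ω ∂P₀, ‖g ω‖ ≤ 2 := hg.mono fun ω h => by
    rw [Real.norm_eq_abs, abs_of_pos h.1]; exact h.2.le
  have hwint : Integrable w P₀ :=
    Integrable.of_bound hwm.aestronglyMeasurable 1 (.of_forall fun ω => by
      rw [Real.norm_eq_abs, abs_of_pos (hw ω)]; exact hw1 ω)
  have hgwint : Integrable (fun ω => g ω * w ω) P₀ :=
    hwint.bdd_mul hgm.aestronglyMeasurable hgb
  have hgwpos : ∀ᵐ ω ∂P₀, 0 < g ω * w ω := hg.mono fun ω h => mul_pos h.1 (hw ω)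
  let c : ℝ := ∫ ω, g ω * w ω ∂P₀
  have hc : 0 < c := by
    refine (integral_nonneg_of_ae (hgwpos.mono fun _ h => h.le)).lt_of_ne' fun h0 => ?_
    rw [integral_eq_zero_iff_of_nonneg_ae (hgwpos.mono fun _ h => h.le) hgwint] at h0
    obtain ⟨ω, h, h'⟩ := (hgwpos.and h0).exists
    exact h.ne' h'
  let h : Ω → ℝ := fun ω => c⁻¹ * (g ω * w ω)
  have hhm : Measurable h := measurable_const.mul (hgm.mul hwm)
  have hhpos : ∀ᵐ ω ∂P₀, 0 < h ω := hgwpos.mono fun ω hω => mul_pos (inv_pos.2 hc) hω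
  have hfin : ∀ᵐ ω ∂P₀, ENNReal.ofReal (h ω) < ⊤ := .of_forall fun _ => ENNReal.ofReal_lt_top
  have hcongr : ∀ j, (fun ω => (ENNReal.ofReal (h ω)).toReal • X j ω) =ᵐ[P₀]
      fun ω => c⁻¹ * (g ω * (w ω * X j ω)) := fun j => by
    filter_upwards [hhpos] with ω hω
    rw [ENNReal.toReal_ofReal hω.le, smul_eq_mul]
    simp only [h]
    ring
  refine ⟨P₀.withDensity fun ω => ENNReal.ofReal (h ω), ⟨?_⟩, withDensity_absolutelyContinuous _ _,
    withDensity_absolutelyContinuous' hhm.ennreal_ofReal.aemeasurable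
      (hhpos.mono fun ω hω => (ENNReal.ofReal_pos.2 hω).ne'), fun j => ⟨?_, ?_⟩⟩
  · rw [withDensity_apply _ MeasurableSet.univ, Measure.restrict_univ,
      ← ofReal_integral_eq_lintegral_ofReal (hgwint.const_mul _) (hhpos.mono fun _ h => h.le),
      integral_const_mul, inv_mul_cancel₀ hc.ne', ENNReal.ofReal_one]
  · rw [integrable_withDensity_iff_integrable_smul' hhm.ennreal_ofReal hfin,
      integrable_congr (hcongr j)]
    exact ((hYint j).bdd_mul hgm.aestronglyMeasurable hgb).const_mul _
  · rw [integral_withDensity_eq_integral_toReal_smul hhm.ennreal_ofReal hfin,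
      integral_congr_ae (hcongr j), integral_const_mul, hgY, mul_zero]
end
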